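/- arXiv:2110.00747 — 4 statements merged into one kernel-verified Lean document; each statement's English description precedes it below -/
import Mathlib

section
/- Let ρ̂ be a minimizer of f over the set 𝒟 of density matrices (with the convention f(σ) = +∞ when tr(M_n σ) = 0 for some n). Let (ρ_k) be the iterates of the algorithm ρ₁ = I/D and ρ_{k+1} = exp(log ρ_k + log R(ρ_k)) / tr(exp(log ρ_k + log R(ρ_k))), and set ρ̄_k = (ρ₁ + ⋯ + ρ_k)/k. Then for every ε > 0 and every integer k ≥ (1/ε)·log D, one has f(ρ̄_k) − f(ρ̂) ≤ ε; equivalently, f(ρ̄_k) − f(σ) ≤ (log D)/k for every density matrix σ with tr(M_n σ) > 0 for all n. -/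
open Matrix
open scoped ComplexOrder

/-- `matFun g A`: apply a real function `g` to a Hermitian matrix `A` via its spectral
decomposition (junk value `0` if `A` is not Hermitian). -/
noncomputable def matFun {D : ℕ} (g : ℝ → ℝ) (A : Matrix (Fin D) (Fin D) ℂ) :
    Matrix (Fin D) (Fin D) ℂ :=
  if hA : A.IsHermitian then
    (hA.eigenvectorUnitary : Matrix (Fin D) (Fin D) ℂ) *
      Matrix.diagonal (fun i => (g (hA.eigenvalues i) : ℂ)) *
      star (hA.eigenvectorUnitary : Matrix (Fin D) (Fin D) ℂ)
  else 0

/-- Matrix logarithm of a Hermitian (positive definite) matrix. -/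
noncomputable def mlog {D : ℕ} (A : Matrix (Fin D) (Fin D) ℂ) : Matrix (Fin D) (Fin D) ℂ :=
  matFun Real.log A

/-- Matrix exponential of a Hermitian matrix. -/
noncomputable def mexp {D : ℕ} (A : Matrix (Fin D) (Fin D) ℂ) : Matrix (Fin D) (Fin D) ℂ :=
  matFun Real.exp A

/-- `R(ρ) = (1/N) ∑ₙ Mₙ / tr(Mₙ ρ)`. -/
noncomputable def Rmat {D N : ℕ} (M : Fin N → Matrix (Fin D) (Fin D) ℂ)
    (ρ : Matrix (Fin D) (Fin D) ℂ) : Matrix (Fin D) (Fin D) ℂ :=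
  (N : ℝ)⁻¹ • ∑ n, (((M n * ρ).trace.re)⁻¹ • M n)

/-- `f(ρ) = (1/N) ∑ₙ −log tr(Mₙ ρ)`. -/
noncomputable def fobj {D N : ℕ} (M : Fin N → Matrix (Fin D) (Fin D) ℂ)
    (ρ : Matrix (Fin D) (Fin D) ℂ) : ℝ :=
  (N : ℝ)⁻¹ * ∑ n, (- Real.log ((M n * ρ).trace.re))

lemma aux_spec {D : ℕ} {A : Matrix (Fin D) (Fin D) ℂ} (hA : A.IsHermitian) :
    ∃ (U : Matrix (Fin D) (Fin D) ℂ) (l : Fin D → ℝ), Uᴴ * U = 1 ∧ U * Uᴴ = 1 ∧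
      A = U * diagonal (fun i => (l i : ℂ)) * Uᴴ ∧
      (∀ g, matFun g A = U * diagonal (fun i => (g (l i) : ℂ)) * Uᴴ) ∧
      (A.PosSemidef → ∀ i, 0 ≤ l i) ∧ (A.PosDef → ∀ i, 0 < l i) := by
  refine ⟨hA.eigenvectorUnitary, hA.eigenvalues, ?_, ?_, ?_, ?_, ?_, ?_⟩
  · exact Unitary.coe_star_mul_self hA.eigenvectorUnitary
  · exact Unitary.coe_mul_star_self hA.eigenvectorUnitary
  · exact hA.spectral_theorem
  · intro g
    rw [matFun, dif_pos hA]
    rfl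
  · intro h i
    exact h.eigenvalues_nonneg i
  · intro h i
    exact h.eigenvalues_pos i

lemma matFun_eq_cfc {D : ℕ} {A : Matrix (Fin D) (Fin D) ℂ} (hA : A.IsHermitian) (g : ℝ → ℝ) :
    matFun g A = cfc g A := by
  rw [hA.cfc_eq, matFun, dif_pos hA]
  rfl

lemma aux_contOn {D : ℕ} (A : Matrix (Fin D) (Fin D) ℂ) (g : ℝ → ℝ) :
    ContinuousOn g (spectrum ℝ A) := by
  rw [continuousOn_iff_continuous_domRestrict]; fun_prop

lemma aux_trace {D : ℕ} (S U : Matrix (Fin D) (Fin D) ℂ) (d : Fin D → ℂ) :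
    (S * (U * diagonal d * Uᴴ)).trace = ∑ j, d j * (Uᴴ * S * U) j j := by
  have : (S * (U * diagonal d * Uᴴ)).trace = (diagonal d * (Uᴴ * S * U)).trace := by
    rw [trace_mul_comm, Matrix.mul_assoc, Matrix.mul_assoc, trace_mul_comm]
    simp only [Matrix.mul_assoc]
  rw [this]
  simp [trace, diagonal_mul]

lemma aux_trace_re {D : ℕ} (S U : Matrix (Fin D) (Fin D) ℂ) (d : Fin D → ℝ) :
    (S * (U * diagonal (fun i => (d i : ℂ)) * Uᴴ)).trace.re
      = ∑ j, ((Uᴴ * S * U) j j).re * d j := by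
  rw [aux_trace, Complex.re_sum]
  refine Finset.sum_congr rfl fun j _ => ?_
  rw [Complex.re_ofReal_mul, mul_comm]

lemma aux_trace_one {D : ℕ} (S U : Matrix (Fin D) (Fin D) ℂ) (hU : U * Uᴴ = 1) :
    ∑ j, ((Uᴴ * S * U) j j).re = S.trace.re := by
  have := aux_trace_re S U (fun _ => 1)
  simpa [hU] using this.symm

lemma matFun_herm {D : ℕ} {A : Matrix (Fin D) (Fin D) ℂ} (hA : A.IsHermitian) (g : ℝ → ℝ) :
    (matFun g A).IsHermitian := by
  rw [matFun_eq_cfc hA]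
  exact cfc_predicate (p := IsSelfAdjoint) g A

lemma mexp_posDef {D : ℕ} {A : Matrix (Fin D) (Fin D) ℂ} (hA : A.IsHermitian) :
    (mexp A).PosDef := by
  obtain ⟨U, l, h1, h2, -, h4, -, -⟩ := aux_spec hA
  rw [mexp, h4]
  have hd : (diagonal (fun i => (Real.exp (l i) : ℂ))).PosDef := by
    apply PosDef.diagonal
    intro i
    exact_mod_cast Real.exp_pos (l i)
  apply hd.mul_mul_conjTranspose_same
  intro x y hxy
  have := congrArg (fun z => z ᵥ* Uᴴ) hxy
  simpa [vecMul_vecMul, h2] using this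

/-- `log (c exp A) = A + log c`. -/
lemma mlog_smul_mexp {D : ℕ} {A : Matrix (Fin D) (Fin D) ℂ} (hA : A.IsHermitian)
    {c : ℝ} (hc : 0 < c) :
    mlog ((c : ℂ) • mexp A) = A + (Real.log c : ℂ) • (1 : Matrix (Fin D) (Fin D) ℂ) := by
  have hA' : IsSelfAdjoint A := hA
  have e1 : (c : ℂ) • mexp A = cfc (fun x => c * Real.exp x) A := by
    rw [mexp, matFun_eq_cfc hA, cfc_const_mul c Real.exp A (aux_contOn _ _)]
    ext i j; simp
  have hH : (cfc (fun x => c * Real.exp x) A).IsHermitian := cfc_predicate (p := IsSelfAdjoint) _ A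
  rw [e1, mlog, matFun_eq_cfc hH, ← cfc_comp' Real.log _ A
    ((Set.Finite.image _ A.finite_real_spectrum).continuousOn _) (aux_contOn _ _)]
  have : cfc (fun x => Real.log (c * Real.exp x)) A = cfc (fun x => x + Real.log c) A := by
    apply cfc_congr
    intro x _
    simp only
    rw [Real.log_mul hc.ne' (Real.exp_pos x).ne', Real.log_exp, add_comm]
  rw [this, cfc_add_const (Real.log c) (fun x => x) A (aux_contOn _ _), cfc_id' ℝ A]
  congr 1
  ext i j
  simp [Algebra.algebraMap_eq_smul_one]

open Filter Topology in
lemma aux_scalar {ι κ : Type*} [Fintype ι] [Fintype κ] (p a : ι → ℝ) (q x : κ → ℝ)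
    (ha : ∀ i, 0 < a i) (hx : ∀ i, 0 < x i) (hpq : ∑ i, p i = ∑ i, q i)
    (h : ∀ t : ℝ, 0 ≤ t → ∑ i, q i / (x i + t) ≤ ∑ i, p i / (a i + t)) :
    ∑ i, p i * Real.log (a i) ≤ ∑ i, q i * Real.log (x i) := by
  set F : ℝ → ℝ := fun t => ∑ i, q i * Real.log (x i + t) - ∑ i, p i * Real.log (a i + t) with hF
  have hder : ∀ t : ℝ, 0 ≤ t → HasDerivAt F (∑ i, q i / (x i + t) - ∑ i, p i / (a i + t)) t := by
    intro t ht
    have aux : ∀ (c y : ℝ), 0 < y → HasDerivAt (fun s => c * Real.log (y + s)) (c / (y + t)) t := by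
      intro c y hy
      have := (((hasDerivAt_id t).const_add y).log (by simp; positivity)).const_mul c
      simpa [div_eq_mul_inv] using this
    exact (HasDerivAt.fun_sum fun i _ => aux (q i) (x i) (hx i)).sub
      (HasDerivAt.fun_sum fun i _ => aux (p i) (a i) (ha i))
  have hanti : AntitoneOn F (Set.Ici 0) := by
    apply antitoneOn_of_deriv_nonpos (convex_Ici 0)
    · intro t ht
      exact (hder t ht).continuousAt.continuousWithinAt
    · intro t ht
      rw [interior_Ici] at ht
      exact (hder t (le_of_lt ht)).differentiableAt.differentiableWithinAt
    · intro t ht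
      rw [interior_Ici] at ht
      rw [(hder t (le_of_lt ht)).deriv]
      linarith [h t (le_of_lt ht)]
  have hlim : Tendsto F atTop (𝓝 0) := by
    have aux : ∀ (c y : ℝ), Tendsto (fun t : ℝ => c * (Real.log (y + t) - Real.log t)) atTop (𝓝 0) := by
      intro c y
      have h1 : Tendsto (fun t : ℝ => y / t + 1) atTop (𝓝 1) := by
        have := (tendsto_const_nhds (x := y)).div_atTop (tendsto_id (α := ℝ) (x := atTop))
        simpa using this.add_const 1
      have h2 := ((Real.continuousAt_log one_ne_zero).tendsto.comp h1).const_mul c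
      rw [Real.log_one, mul_zero] at h2
      refine h2.congr' ?_
      filter_upwards [eventually_gt_atTop 0, eventually_gt_atTop (-y)] with t ht ht'
      simp only [Function.comp]
      rw [← Real.log_div (by linarith) ht.ne']
      congr 2
      field_simp
    have h1 := (tendsto_finsetSum (Finset.univ) fun i _ => aux (q i) (x i)).sub
      (tendsto_finsetSum (Finset.univ) fun i _ => aux (p i) (a i))
    simp only [Finset.sum_const_zero, sub_zero] at h1
    refine h1.congr fun t => ?_
    simp only [hF, mul_sub, Finset.sum_sub_distrib, ← Finset.sum_mul, hpq]
    ring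
  have h0 : 0 ≤ F 0 := by
    refine le_of_tendsto hlim ?_
    filter_upwards [eventually_ge_atTop 0] with t ht
    exact hanti (Set.mem_Ici.2 le_rfl) ht ht
  simp only [hF, add_zero] at h0
  linarith

lemma psd_factor {D : ℕ} {A : Matrix (Fin D) (Fin D) ℂ} (hA : A.PosSemidef) :
    ∃ C : Matrix (Fin D) (Fin D) ℂ, A = Cᴴ * C := by
  obtain ⟨U, l, h1, h2, h3, -, h5, -⟩ := aux_spec hA.1
  refine ⟨diagonal (fun i => (Real.sqrt (l i) : ℂ)) * Uᴴ, ?_⟩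
  rw [conjTranspose_mul, conjTranspose_conjTranspose, diagonal_conjTranspose]
  conv_lhs => rw [h3]
  have e : ∀ d : Fin D → ℂ, U * diagonal d * (diagonal d * Uᴴ) = U * (diagonal d * diagonal d) * Uᴴ := by
    intro d
    simp only [Matrix.mul_assoc]
  have e0 : (star fun i => (Real.sqrt (l i) : ℂ)) = fun i => (Real.sqrt (l i) : ℂ) := by
    funext i
    simp
  rw [e0, e, diagonal_mul_diagonal]
  congr 3
  funext i
  simp only [← Complex.ofReal_mul]
  rw [Real.mul_self_sqrt (h5 hA i)]

lemma psd_trace_re {D : ℕ} {A : Matrix (Fin D) (Fin D) ℂ} (hA : A.PosSemidef) :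
    0 ≤ A.trace.re := (Complex.le_def.1 hA.trace_nonneg).1

lemma psd_trace_mul {D : ℕ} {A B : Matrix (Fin D) (Fin D) ℂ} (hA : A.PosSemidef)
    (hB : B.PosSemidef) : 0 ≤ (A * B).trace.re := by
  obtain ⟨C, rfl⟩ := psd_factor hB
  rw [← Matrix.mul_assoc, trace_mul_comm, ← Matrix.mul_assoc]
  exact psd_trace_re (hA.mul_mul_conjTranspose_same C)

lemma psd_mul_eq_zero {D : ℕ} {A B : Matrix (Fin D) (Fin D) ℂ} (hA : A.PosSemidef)
    (hB : B.PosSemidef) (h : (A * B).trace = 0) : A * B = 0 := by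
  obtain ⟨C, rfl⟩ := psd_factor hB
  obtain ⟨E, rfl⟩ := psd_factor hA
  rw [← Matrix.mul_assoc, trace_mul_comm] at h
  have h2 : ((E * Cᴴ)ᴴ * (E * Cᴴ)).trace = 0 := by
    rw [← h]; simp [Matrix.mul_assoc]
  rw [trace_conjTranspose_mul_self_eq_zero_iff] at h2
  calc Eᴴ * E * (Cᴴ * C) = Eᴴ * (E * Cᴴ) * C := by simp only [Matrix.mul_assoc]
    _ = 0 := by simp [h2]

lemma aux_jensen {D N : ℕ} (B : Fin N → Matrix (Fin D) (Fin D) ℂ) (hB : ∀ n, (B n).PosSemidef)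
    (a : Fin N → ℝ) (ha : ∀ n, 0 < a n) (σ R : Matrix (Fin D) (Fin D) ℂ) (hσ : σ.PosSemidef)
    (hBσ : (∑ n, B n) * σ = σ) (hB1 : (1 - ∑ n, B n).PosSemidef)
    (hR : R = ∑ n, (a n : ℂ) • B n) (hRp : R.PosDef) :
    ∑ n, (B n * σ).trace.re * Real.log (a n) ≤ (σ * mlog R).trace.re := by
  obtain ⟨U, l, h1, h2, h3, h4, -, h6⟩ := aux_spec hRp.1
  have hl := h6 hRp
  rw [mlog, h4, aux_trace_re σ U (fun i => Real.log (l i))]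
  apply aux_scalar _ _ _ _ ha hl
  · rw [aux_trace_one σ U h2]
    conv_rhs => rw [← hBσ]
    rw [Finset.sum_mul, trace_sum, Complex.re_sum]
  intro t ht
  set Y : Matrix (Fin D) (Fin D) ℂ := U * diagonal (fun i => (((l i + t)⁻¹ : ℝ) : ℂ)) * Uᴴ with hY
  have hYs : Yᴴ = Y := by
    rw [hY]
    simp only [conjTranspose_mul, conjTranspose_conjTranspose, diagonal_conjTranspose,
      Matrix.mul_assoc]
    congr 3
    funext i
    simp
  have hRY : (R + (t : ℂ) • 1) * Y = 1 := by
    have e : R + (t : ℂ) • 1 = U * diagonal (fun i => ((l i + t : ℝ) : ℂ)) * Uᴴ := by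
      have : diagonal (fun i => ((l i + t : ℝ) : ℂ))
          = diagonal (fun i => (l i : ℂ)) + (t : ℂ) • (1 : Matrix (Fin D) (Fin D) ℂ) := by
        rw [smul_one_eq_diagonal, diagonal_add]
        simp
      rw [this, Matrix.mul_add, Matrix.add_mul, ← h3]
      simp [h2]
    rw [e, hY]
    calc _ = U * diagonal (fun i => ((l i + t : ℝ) : ℂ)) * (Uᴴ * U) *
          diagonal (fun i => (((l i + t)⁻¹ : ℝ) : ℂ)) * Uᴴ := by simp only [Matrix.mul_assoc]
      _ = U * (diagonal (fun i => ((l i + t : ℝ) : ℂ)) *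
          diagonal (fun i => (((l i + t)⁻¹ : ℝ) : ℂ))) * Uᴴ := by
            rw [h1]; simp only [Matrix.mul_assoc, Matrix.mul_one]
      _ = 1 := by
        rw [diagonal_mul_diagonal]
        have : (fun i => ((l i + t : ℝ) : ℂ) * (((l i + t)⁻¹ : ℝ) : ℂ)) = fun _ => 1 := by
          funext i
          rw [← Complex.ofReal_mul, mul_inv_cancel₀ (by linarith [hl i])]
          simp
        rw [this]
        simp [h2]
  have hq : ∑ i, ((Uᴴ * σ * U) i i).re / (l i + t) = (Y * σ).trace.re := by
    rw [trace_mul_comm, hY, aux_trace_re σ U (fun i => (l i + t)⁻¹)]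
    simp [div_eq_mul_inv]
  rw [hq]
  have hc : ∀ n, 0 < a n + t := fun n => by linarith [ha n]
  have hσB : σ * (∑ n, B n) = σ := by
    have := congrArg conjTranspose hBσ
    rw [conjTranspose_mul, conjTranspose_sum, hσ.1.eq] at this
    simpa only [(hB _).1.eq] using this
  have key : ∀ n, 0 ≤ (B n * σ).trace.re / (a n + t) - (B n * (Y * σ)).trace.re
      - (Y * (B n * σ)).trace.re + (Y * (((a n + t : ℝ) : ℂ) • B n) * (Y * σ)).trace.re := by
    intro n
    have h := psd_trace_mul ((hB n).mul_mul_conjTranspose_same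
      (1 - ((a n + t : ℝ) : ℂ) • Y)) hσ
    have e : (1 - ((a n + t : ℝ) : ℂ) • Y)ᴴ = (1 - ((a n + t : ℝ) : ℂ) • Y) := by
      rw [conjTranspose_sub, conjTranspose_smul, hYs]
      simp
    rw [e] at h
    have e2 : ((1 - ((a n + t : ℝ) : ℂ) • Y) * B n * (1 - ((a n + t : ℝ) : ℂ) • Y) * σ).trace.re
      = (a n + t) * ((B n * σ).trace.re / (a n + t) - (B n * (Y * σ)).trace.re
      - (Y * (B n * σ)).trace.re + (Y * (((a n + t : ℝ) : ℂ) • B n) * (Y * σ)).trace.re) := by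
      have hcn := (hc n).ne'
      generalize a n + t = c at *
      have : (1 - (c : ℂ) • Y) * B n * (1 - (c : ℂ) • Y) * σ
        = B n * σ - (c : ℂ) • (B n * (Y * σ)) - (c : ℂ) • (Y * (B n * σ))
          + (c : ℂ) • (Y * ((c : ℂ) • B n) * (Y * σ)) := by
        simp only [Matrix.sub_mul, Matrix.mul_sub, Matrix.one_mul, Matrix.mul_one,
          Matrix.smul_mul, Matrix.mul_smul, Matrix.mul_assoc, smul_sub]
        abel
      rw [this]
      simp only [trace_add, trace_sub, trace_smul, smul_eq_mul, Complex.add_re, Complex.sub_re,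
        Complex.re_ofReal_mul]
      field_simp
    rw [e2] at h
    exact nonneg_of_mul_nonneg_right h (hc n)
  have hsum := Finset.sum_nonneg fun n (_ : n ∈ Finset.univ) => key n
  simp only [Finset.sum_add_distrib, Finset.sum_sub_distrib, ← Complex.re_sum, ← trace_sum,
    ← Finset.sum_mul, ← Finset.mul_sum] at hsum
  rw [hBσ, ← Matrix.mul_assoc, trace_mul_comm, ← Matrix.mul_assoc, hσB,
    trace_mul_comm σ Y] at hsum
  have e3 : ∑ n, (((a n + t : ℝ) : ℂ) • B n) = (R + (t : ℂ) • 1) - (t : ℂ) • (1 - ∑ n, B n) := by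
    rw [hR, smul_sub, Finset.smul_sum]
    simp only [Complex.ofReal_add, add_smul, Finset.sum_add_distrib]
    abel
  rw [e3] at hsum
  have e4 : (Y * (R + (t : ℂ) • 1 - (t : ℂ) • (1 - ∑ n, B n)) * (Y * σ)).trace.re
      = (Y * σ).trace.re - t * (Y * (1 - ∑ n, B n) * Yᴴ * σ).trace.re := by
    have : Y * (R + (t : ℂ) • 1 - (t : ℂ) • (1 - ∑ n, B n)) * (Y * σ)
        = Y * ((R + (t : ℂ) • 1) * Y) * σ - (t : ℂ) • (Y * (1 - ∑ n, B n) * Yᴴ * σ) := by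
      rw [hYs, Matrix.mul_sub, Matrix.sub_mul]
      simp only [Matrix.mul_smul, Matrix.smul_mul, Matrix.mul_assoc]
    rw [this, hRY, Matrix.mul_one, trace_sub, trace_smul, Complex.sub_re, smul_eq_mul,
      Complex.re_ofReal_mul]
  rw [e4] at hsum
  have := mul_nonneg ht (psd_trace_mul (hB1.mul_mul_conjTranspose_same Y) hσ)
  linarith

lemma aux_G_apply {D : ℕ} (G Z : Matrix (Fin D) (Fin D) ℂ) (p : Fin D → ℂ) (k : Fin D) :
    (Gᴴ * diagonal p * Z) k k = ∑ i, star (G i k) * p i * Z i k := by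
  rw [mul_apply]
  simp only [mul_diagonal, conjTranspose_apply]

lemma aux_G {D : ℕ} (G Z : Matrix (Fin D) (Fin D) ℂ) (p : Fin D → ℝ) :
    (Gᴴ * diagonal (fun i => (p i : ℂ)) * Z).trace.re
      = ∑ i, ∑ k, p i * (star (G i k) * Z i k).re := by
  simp only [trace, diag, aux_G_apply, Complex.re_sum]
  rw [Finset.sum_comm]
  refine Finset.sum_congr rfl fun i _ => Finset.sum_congr rfl fun k _ => ?_
  rw [← Complex.re_ofReal_mul]
  congr 1
  ring

lemma aux_entropy {D : ℕ} (τ ρ W : Matrix (Fin D) (Fin D) ℂ) (hτ : τ.PosDef) (hρ : ρ.PosDef)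
    (hW1 : Wᴴ * W = 1) (hW2 : W * Wᴴ = 1) :
    (τ * mlog ρ).trace.re - (τ * mlog τ).trace.re ≤
      ∑ j, ((Wᴴ * τ * W) j j).re *
        Real.log (((Wᴴ * ρ * W) j j).re / ((Wᴴ * τ * W) j j).re) := by
  obtain ⟨U, p, hU1, hU2, hU3, hU4, -, hU6⟩ := aux_spec hτ.1
  obtain ⟨V, q, hV1, hV2, hV3, hV4, -, hV6⟩ := aux_spec hρ.1
  have hp := hU6 hτ
  have hq := hV6 hρ
  have hWinj : Function.Injective W.mulVec := by
    intro x y hxy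
    have := congrArg (fun z => Wᴴ *ᵥ z) hxy
    simpa [mulVec_mulVec, hW1] using this
  have hτj : ∀ j, 0 < ((Wᴴ * τ * W) j j).re := fun j =>
    (Complex.lt_def.1 (hτ.conjTranspose_mul_mul_same hWinj).diag_pos).1
  have hρj : ∀ j, 0 < ((Wᴴ * ρ * W) j j).re := fun j =>
    (Complex.lt_def.1 (hρ.conjTranspose_mul_mul_same hWinj).diag_pos).1
  set G := Uᴴ * V with hG
  have hGG : G * Gᴴ = 1 := by
    rw [hG, conjTranspose_mul, conjTranspose_conjTranspose]
    calc _ = Uᴴ * (V * Vᴴ) * U := by simp only [Matrix.mul_assoc]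
      _ = 1 := by rw [hV2]; simp [hU1]
  have hrow : ∀ i, ∑ k, Complex.normSq (G i k) = 1 := by
    intro i
    have := congrArg Complex.re (congrFun (congrFun hGG i) i)
    simpa [mul_apply, Complex.normSq_apply] using this
  have hcol : ∀ k, ((Vᴴ * τ * V) k k).re = ∑ i, Complex.normSq (G i k) * p i := by
    intro k
    have : Vᴴ * τ * V = Gᴴ * diagonal (fun i => (p i : ℂ)) * G := by
      conv_lhs => rw [hU3]
      simp only [hG, conjTranspose_mul, conjTranspose_conjTranspose, Matrix.mul_assoc]
    rw [this]
    simp only [aux_G_apply, Complex.re_sum]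
    refine Finset.sum_congr rfl fun i _ => ?_
    simp [Complex.normSq_apply]
    ring
  have hττ : ∀ i, ((Uᴴ * τ * U) i i).re = p i := by
    intro i
    have : Uᴴ * τ * U = diagonal (fun i => (p i : ℂ)) := by
      conv_lhs => rw [hU3]
      calc _ = (Uᴴ * U) * diagonal (fun i => (p i : ℂ)) * (Uᴴ * U) := by
            simp only [Matrix.mul_assoc]
        _ = _ := by simp [hU1]
    rw [this]
    simp
  have hL : (τ * mlog ρ).trace.re - (τ * mlog τ).trace.re
      = ∑ ik : Fin D × Fin D, (Complex.normSq (G ik.1 ik.2) * p ik.1) *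
        Real.log (q ik.2 / p ik.1) := by
    rw [mlog, mlog, hU4, hV4, aux_trace_re τ U (fun i => Real.log (p i)),
      aux_trace_re τ V (fun i => Real.log (q i)), Fintype.sum_prod_type]
    simp only [hcol, hττ]
    have e1 : ∑ i, p i * Real.log (p i)
        = ∑ i, ∑ k, Complex.normSq (G i k) * p i * Real.log (p i) := by
      refine Finset.sum_congr rfl fun i _ => ?_
      rw [← Finset.sum_mul, ← Finset.sum_mul, hrow, one_mul]
    simp only [Finset.sum_mul]
    rw [e1, Finset.sum_comm, ← Finset.sum_sub_distrib]
    refine Finset.sum_congr rfl fun i _ => ?_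
    rw [← Finset.sum_sub_distrib]
    refine Finset.sum_congr rfl fun k _ => ?_
    rw [Real.log_div (hq k).ne' (hp i).ne']
    ring
  rw [hL]
  apply aux_scalar _ (fun ik : Fin D × Fin D => q ik.2 / p ik.1) _
    (fun j => ((Wᴴ * ρ * W) j j).re / ((Wᴴ * τ * W) j j).re)
    (fun ik => div_pos (hq _) (hp _)) (fun j => div_pos (hρj j) (hτj j))
  · rw [aux_trace_one τ W hW2, Fintype.sum_prod_type, ← aux_trace_one τ U hU2]
    refine Finset.sum_congr rfl fun i _ => ?_
    rw [hττ]
    simp only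
    rw [← Finset.sum_mul, hrow, one_mul]
  intro t ht
  set y : Fin D → ℝ := fun j =>
    ((Wᴴ * τ * W) j j).re / (((Wᴴ * ρ * W) j j).re + t * ((Wᴴ * τ * W) j j).re) with hy
  set X : Matrix (Fin D) (Fin D) ℂ := W * diagonal (fun i => (y i : ℂ)) * Wᴴ with hX
  have hXs : Xᴴ = X := by
    rw [hX]
    simp only [conjTranspose_mul, conjTranspose_conjTranspose, diagonal_conjTranspose,
      Matrix.mul_assoc]
    congr 3
    funext i
    simp
  have hXX : X * X = W * diagonal (fun i => ((y i ^ 2 : ℝ) : ℂ)) * Wᴴ := by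
    calc _ = W * diagonal (fun i => (y i : ℂ)) * (Wᴴ * W) * diagonal (fun i => (y i : ℂ)) * Wᴴ := by
            simp only [hX, Matrix.mul_assoc]
        _ = W * (diagonal (fun i => (y i : ℂ)) * diagonal (fun i => (y i : ℂ))) * Wᴴ := by
            rw [hW1]; simp only [Matrix.mul_assoc, Matrix.mul_one]
        _ = _ := by
          rw [diagonal_mul_diagonal]
          simp [sq]
  set Z := Uᴴ * X * V with hZ
  have F3 : ∑ i, ∑ k, p i * (star (G i k) * Z i k).re = ∑ j, ((Wᴴ * τ * W) j j).re * y j := by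
    rw [← aux_G, ← aux_trace_re τ W y, ← hX]
    have : Gᴴ * diagonal (fun i => (p i : ℂ)) * Z = Vᴴ * (τ * X * V) := by
      conv_rhs => rw [hU3]
      simp only [hG, hZ, conjTranspose_mul, conjTranspose_conjTranspose, Matrix.mul_assoc]
    rw [this, trace_mul_comm, Matrix.mul_assoc, hV2, Matrix.mul_one]
  have F2 : ∑ i, ∑ k, p i * Complex.normSq (Z i k)
      = ∑ j, ((Wᴴ * τ * W) j j).re * y j ^ 2 := by
    rw [← aux_trace_re τ W (fun j => y j ^ 2), ← hXX]
    have e := aux_G Z Z p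
    have : Zᴴ * diagonal (fun i => (p i : ℂ)) * Z = Vᴴ * (X * τ * X * V) := by
      conv_rhs => rw [hU3]
      simp only [hZ, conjTranspose_mul, conjTranspose_conjTranspose, Matrix.mul_assoc, hXs]
    rw [this, trace_mul_comm, Matrix.mul_assoc, hV2, Matrix.mul_one, Matrix.mul_assoc,
      trace_mul_comm, Matrix.mul_assoc] at e
    rw [e]
    simp [Complex.normSq_apply]
  have F1 : ∑ i, ∑ k, q k * Complex.normSq (Z i k)
      = ∑ j, ((Wᴴ * ρ * W) j j).re * y j ^ 2 := by
    rw [← aux_trace_re ρ W (fun j => y j ^ 2), ← hXX, Finset.sum_comm]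
    have e := aux_G Zᴴ Zᴴ q
    have : Zᴴᴴ * diagonal (fun i => (q i : ℂ)) * Zᴴ = Uᴴ * (X * ρ * X * U) := by
      conv_rhs => rw [hV3]
      simp only [hZ, conjTranspose_mul, conjTranspose_conjTranspose, Matrix.mul_assoc, hXs]
    rw [this, trace_mul_comm, Matrix.mul_assoc, hU2, Matrix.mul_one, Matrix.mul_assoc,
      trace_mul_comm, Matrix.mul_assoc] at e
    rw [e]
    simp [Complex.normSq_apply]
  have hleft : ∀ j, ((Wᴴ * τ * W) j j).re / (((Wᴴ * ρ * W) j j).re / ((Wᴴ * τ * W) j j).re + t)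
      = 2 * (((Wᴴ * τ * W) j j).re * y j) - ((Wᴴ * ρ * W) j j).re * y j ^ 2
        - t * (((Wᴴ * τ * W) j j).re * y j ^ 2) := by
    intro j
    simp only [hy]
    have h1 := hτj j
    have h2 := hρj j
    generalize ((Wᴴ * τ * W) j j).re = u at *
    generalize ((Wᴴ * ρ * W) j j).re = v at *
    have h3 : v + t * u ≠ 0 := by positivity
    have h4 : v / u + t = (v + t * u) / u := by field_simp
    rw [h4]
    field_simp
    ring
  have hright : ∀ i k, 2 * (p i * (star (G i k) * Z i k).re) - q k * Complex.normSq (Z i k)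
      - t * (p i * Complex.normSq (Z i k)) ≤ Complex.normSq (G i k) * p i / (q k / p i + t) := by
    intro i k
    have h1 := hp i
    have h2 := hq k
    generalize p i = u at *
    generalize q k = v at *
    have h3 : 0 < v + t * u := by positivity
    have h4 : v / u + t = (v + t * u) / u := by field_simp
    rw [h4, div_div_eq_mul_div, le_div_iff₀ h3]
    simp only [Complex.normSq_apply, Complex.mul_re, Complex.star_def, Complex.conj_re,
      Complex.conj_im]
    nlinarith [sq_nonneg (u * (G i k).re - (v + t * u) * (Z i k).re),
      sq_nonneg (u * (G i k).im - (v + t * u) * (Z i k).im)]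
  simp only [hleft]
  rw [Fintype.sum_prod_type]
  refine le_trans (le_of_eq ?_) (Finset.sum_le_sum fun i _ => Finset.sum_le_sum fun k _ =>
    hright i k)
  simp only [Finset.sum_sub_distrib, ← Finset.mul_sum]
  simp only [← Finset.mul_sum] at F1 F2 F3
  simp only [F2, F3]
  simp only [← F1]

lemma psd_trace_ofReal {D : ℕ} {A : Matrix (Fin D) (Fin D) ℂ} (hA : A.PosSemidef) :
    A.trace = (A.trace.re : ℂ) := by
  apply Complex.ext
  · simp
  · simpa using (Complex.le_def.1 hA.trace_nonneg).2.symm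

lemma psd_trace_mul_pos {D : ℕ} {A B : Matrix (Fin D) (Fin D) ℂ} (hA : A.PosSemidef)
    (hA0 : A ≠ 0) (hB : B.PosDef) : 0 < (A * B).trace.re := by
  refine lt_of_le_of_ne (psd_trace_mul hA hB.posSemidef) fun h => hA0 ?_
  have him : (A * B).trace = 0 := by
    obtain ⟨C, hC⟩ := psd_factor hB.posSemidef
    have hP := hA.mul_mul_conjTranspose_same C
    have e : (A * B).trace = (C * A * Cᴴ).trace := by
      rw [hC, ← Matrix.mul_assoc, trace_mul_comm, ← Matrix.mul_assoc]
    rw [e] at h ⊢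
    rw [psd_trace_ofReal hP, ← h]
    simp
  have hz := psd_mul_eq_zero hA hB.posSemidef him
  obtain ⟨u, hu⟩ := hB.isUnit
  rw [← hu] at hz
  simpa using hz

lemma aux_normSq {D : ℕ} (C : Matrix (Fin D) (Fin D) ℂ) :
    (Cᴴ * C).trace.re = ∑ j, ∑ i, ‖C i j‖ ^ 2 := by
  simp only [trace, diag, mul_apply, conjTranspose_apply, Complex.re_sum]
  refine Finset.sum_congr rfl fun j _ => Finset.sum_congr rfl fun i _ => ?_
  rw [Complex.sq_norm, Complex.normSq_apply]
  simp

lemma aux_max {D N : ℕ} (M : Fin N → Matrix (Fin D) (Fin D) ℂ)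
    (σ : Matrix (Fin D) (Fin D) ℂ) (hσ : σ.PosSemidef) (hσtr : σ.trace = 1) :
    ∃ s : Matrix (Fin D) (Fin D) ℂ, s.PosSemidef ∧ s.trace = 1 ∧
      ∀ τ : Matrix (Fin D) (Fin D) ℂ, τ.PosSemidef → τ.trace = 1 →
        ∏ n, (M n * τ).trace.re ≤ ∏ n, (M n * s).trace.re := by
  set K : Set (Matrix (Fin D) (Fin D) ℂ) := {C | (Cᴴ * C).trace.re = 1} with hK
  have hKc : IsCompact K := by
    have hbig : IsCompact (Set.pi Set.univ
        (fun _ : Fin D => Set.pi Set.univ (fun _ : Fin D => Metric.closedBall (0 : ℂ) 1))) :=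
      isCompact_univ_pi fun _ => isCompact_univ_pi fun _ => isCompact_closedBall 0 1
    refine IsCompact.of_isClosed_subset hbig ?_ ?_
    · apply isClosed_eq
      · fun_prop
      · fun_prop
    · intro C hC
      refine Set.mem_univ_pi.2 fun i => Set.mem_univ_pi.2 fun j => ?_
      rw [mem_closedBall_zero_iff]
      have h1 : (Cᴴ * C).trace.re = 1 := hC
      rw [aux_normSq] at h1
      have h2 : ‖C i j‖ ^ 2 ≤ 1 := by
        rw [← h1]
        refine le_trans (Finset.single_le_sum (f := fun i => ‖C i j‖ ^ 2)
          (fun _ _ => by positivity) (Finset.mem_univ i)) ?_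
        exact Finset.single_le_sum (f := fun j => ∑ i, ‖C i j‖ ^ 2)
          (fun _ _ => by positivity) (Finset.mem_univ j)
      nlinarith [norm_nonneg (C i j)]
  have hcont : Continuous fun C : Matrix (Fin D) (Fin D) ℂ => ∏ n, (M n * (Cᴴ * C)).trace.re := by
    fun_prop
  obtain ⟨C0, hC0⟩ := psd_factor hσ
  have hne : K.Nonempty := ⟨C0, by simp [hK, ← hC0, hσtr]⟩
  obtain ⟨C, hC, hmax⟩ := hKc.exists_isMaxOn hne hcont.continuousOn
  have hps := posSemidef_conjTranspose_mul_self C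
  refine ⟨Cᴴ * C, hps, ?_, ?_⟩
  · rw [psd_trace_ofReal hps]
    have : (Cᴴ * C).trace.re = 1 := hC
    rw [this]; simp
  · intro τ hτ hτ1
    obtain ⟨E, rfl⟩ := psd_factor hτ
    exact hmax (show E ∈ K by simp [hK, hτ1])

open Filter Topology in
/-- First order optimality. -/
lemma aux_foc {D N : ℕ} (M : Fin N → Matrix (Fin D) (Fin D) ℂ)
    (hM : ∀ n, (M n).PosSemidef) (s : Matrix (Fin D) (Fin D) ℂ) (hs : s.PosSemidef)
    (hs1 : s.trace = 1) (hpos : ∀ n, 0 < (M n * s).trace.re)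
    (hmax : ∀ τ : Matrix (Fin D) (Fin D) ℂ, τ.PosSemidef → τ.trace = 1 →
        ∏ n, (M n * τ).trace.re ≤ ∏ n, (M n * s).trace.re)
    (τ : Matrix (Fin D) (Fin D) ℂ) (hτ : τ.PosSemidef) :
    ∑ n, (M n * τ).trace.re / (M n * s).trace.re ≤ N * τ.trace.re := by
  have hT := psd_trace_re hτ
  have hβ : ∀ n, 0 ≤ (M n * τ).trace.re / (M n * s).trace.re := fun n =>
    div_nonneg (psd_trace_mul (hM n) hτ) (hpos n).le
  have key : ∀ t : ℝ, 0 < t → ∑ n, ((M n * τ).trace.re / (M n * s).trace.re) /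
      (1 + t * ((M n * τ).trace.re / (M n * s).trace.re)) ≤ N * τ.trace.re := by
    intro t ht
    have hc : 0 < 1 + t * τ.trace.re := by positivity
    have hps : (((1 + t * τ.trace.re)⁻¹ : ℝ) • (s + t • τ)).PosSemidef :=
      (hs.add (hτ.smul ht.le)).smul (inv_nonneg.2 hc.le)
    have htr : (((1 + t * τ.trace.re)⁻¹ : ℝ) • (s + t • τ)).trace = 1 := by
      rw [psd_trace_ofReal hps, trace_smul, trace_add, trace_smul, hs1]
      simp only [Complex.smul_re, Complex.add_re, Complex.one_re, smul_eq_mul]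
      rw [inv_mul_cancel₀ hc.ne']
      simp
    have h := hmax _ hps htr
    have e : ∀ n, (M n * (((1 + t * τ.trace.re)⁻¹ : ℝ) • (s + t • τ))).trace.re
        = (M n * s).trace.re * ((1 + t * τ.trace.re)⁻¹ *
          (1 + t * ((M n * τ).trace.re / (M n * s).trace.re))) := by
      intro n
      rw [Matrix.mul_smul, Matrix.mul_add, Matrix.mul_smul, trace_smul, trace_add, trace_smul]
      simp only [Complex.smul_re, Complex.add_re, smul_eq_mul]
      have := (hpos n).ne'
      field_simp
    simp only [e] at h
    rw [Finset.prod_mul_distrib] at h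
    have hP : 0 < ∏ n, (M n * s).trace.re := Finset.prod_pos fun n _ => hpos n
    have h2 : ∏ n, ((1 + t * τ.trace.re)⁻¹ *
          (1 + t * ((M n * τ).trace.re / (M n * s).trace.re))) ≤ 1 := by
      by_contra hcon
      push Not at hcon
      nlinarith
    have hβt : ∀ n, 0 < 1 + t * ((M n * τ).trace.re / (M n * s).trace.re) := fun n => by
      have := mul_nonneg ht.le (hβ n)
      linarith
    have h3 := Real.log_nonpos (Finset.prod_nonneg fun n _ =>
      mul_nonneg (inv_nonneg.2 hc.le) (hβt n).le) h2
    rw [Real.log_prod (fun n _ => (mul_pos (inv_pos.2 hc) (hβt n)).ne')] at h3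
    have h4 : ∀ n, t * (((M n * τ).trace.re / (M n * s).trace.re) /
        (1 + t * ((M n * τ).trace.re / (M n * s).trace.re))) - t * τ.trace.re ≤
        Real.log ((1 + t * τ.trace.re)⁻¹ *
          (1 + t * ((M n * τ).trace.re / (M n * s).trace.re))) := by
      intro n
      rw [Real.log_mul (inv_pos.2 hc).ne' (hβt n).ne', Real.log_inv]
      have h5 := Real.log_le_sub_one_of_pos hc
      have h6 := Real.one_sub_inv_le_log_of_pos (hβt n)
      have h7 : t * (((M n * τ).trace.re / (M n * s).trace.re) /
        (1 + t * ((M n * τ).trace.re / (M n * s).trace.re)))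
        = 1 - (1 + t * ((M n * τ).trace.re / (M n * s).trace.re))⁻¹ := by
        have := hβt n
        generalize (M n * τ).trace.re / (M n * s).trace.re = b at *
        field_simp
        ring
      linarith
    have h5 := (Finset.sum_le_sum fun n (_ : n ∈ Finset.univ) => h4 n).trans h3
    rw [Finset.sum_sub_distrib, ← Finset.mul_sum, Finset.sum_const, Finset.card_univ,
      Fintype.card_fin, nsmul_eq_mul] at h5
    have h6 : t * (∑ n, ((M n * τ).trace.re / (M n * s).trace.re) /
      (1 + t * ((M n * τ).trace.re / (M n * s).trace.re))) ≤ t * (N * τ.trace.re) := by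
      linarith
    exact le_of_mul_le_mul_left h6 ht
  have hlim : Tendsto (fun t : ℝ => ∑ n, ((M n * τ).trace.re / (M n * s).trace.re) /
      (1 + t * ((M n * τ).trace.re / (M n * s).trace.re))) (𝓝[>] 0)
      (𝓝 (∑ n, (M n * τ).trace.re / (M n * s).trace.re)) := by
    refine tendsto_finsetSum _ fun n _ => ?_
    have : ContinuousAt (fun t : ℝ => ((M n * τ).trace.re / (M n * s).trace.re) /
      (1 + t * ((M n * τ).trace.re / (M n * s).trace.re))) 0 := by
      apply ContinuousAt.div
      · fun_prop
      · fun_prop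
      · simp
    have h := this.tendsto
    simp only [zero_mul, add_zero, div_one] at h
    exact h.mono_left nhdsWithin_le_nhds
  refine le_of_tendsto hlim ?_
  filter_upwards [self_mem_nhdsWithin] with t ht
  exact key t ht

lemma aux_B {D N : ℕ} (hN : 0 < N) (M : Fin N → Matrix (Fin D) (Fin D) ℂ)
    (hM : ∀ n, (M n).PosSemidef) (s : Matrix (Fin D) (Fin D) ℂ) (hs : s.PosSemidef)
    (hs1 : s.trace = 1) (hpos : ∀ n, 0 < (M n * s).trace.re)
    (hmax : ∀ τ : Matrix (Fin D) (Fin D) ℂ, τ.PosSemidef → τ.trace = 1 →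
        ∏ n, (M n * τ).trace.re ≤ ∏ n, (M n * s).trace.re)
    (R ρ : Matrix (Fin D) (Fin D) ℂ) (hR : R = Rmat M ρ) (hRp : R.PosDef)
    (hρpos : ∀ n, 0 < (M n * ρ).trace.re) :
    fobj M ρ - fobj M s ≤ (s * mlog R).trace.re := by
  have hN' : (0 : ℝ) < N := by exact_mod_cast hN
  set b : Fin N → ℝ := fun n => (N : ℝ)⁻¹ * ((M n * s).trace.re)⁻¹ with hb
  have hbpos : ∀ n, 0 < b n := fun n => mul_pos (inv_pos.2 hN') (inv_pos.2 (hpos n))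
  set B : Fin N → Matrix (Fin D) (Fin D) ℂ := fun n => b n • M n with hB
  have hBp : ∀ n, (B n).PosSemidef := fun n => (hM n).smul (hbpos n).le
  have htrB : ∀ (n) (τ : Matrix (Fin D) (Fin D) ℂ),
      (B n * τ).trace.re = b n * (M n * τ).trace.re := by
    intro n τ
    simp only [hB, Matrix.smul_mul, trace_smul, Complex.smul_re, smul_eq_mul]
  have hBherm : (∑ n, B n).IsHermitian := by
    rw [IsHermitian, conjTranspose_sum]
    exact Finset.sum_congr rfl fun n _ => (hBp n).1.eq
  have hB1 : (1 - ∑ n, B n).PosSemidef := by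
    have hH : (1 - ∑ n, B n).IsHermitian := isHermitian_one.sub hBherm
    refine PosSemidef.of_dotProduct_mulVec_nonneg hH fun v => ?_
    have e : ∀ A : Matrix (Fin D) (Fin D) ℂ, star v ⬝ᵥ (A *ᵥ v)
        = (A * vecMulVec v (star v)).trace := by
      intro A
      rw [mul_vecMulVec, trace_vecMulVec, dotProduct_comm]
    have hτ := posSemidef_vecMulVec_self_star v
    set τ := vecMulVec v (star v) with hτd
    have hfoc := aux_foc M hM s hs hs1 hpos hmax τ hτ
    rw [Complex.le_def]
    constructor
    · rw [e, Matrix.sub_mul, Matrix.one_mul, trace_sub, Finset.sum_mul, trace_sum, Complex.sub_re,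
        Complex.re_sum, Complex.zero_re]
      simp only [htrB, hb]
      have : ∑ n, (N : ℝ)⁻¹ * ((M n * s).trace.re)⁻¹ * (M n * τ).trace.re
          = (N : ℝ)⁻¹ * ∑ n, (M n * τ).trace.re / (M n * s).trace.re := by
        rw [Finset.mul_sum]
        refine Finset.sum_congr rfl fun n _ => ?_
        rw [div_eq_mul_inv]; ring
      rw [this]
      have h2 := mul_le_mul_of_nonneg_left hfoc (inv_nonneg.2 hN'.le)
      rw [← mul_assoc, inv_mul_cancel₀ hN'.ne', one_mul] at h2
      linarith
    · have := hH.im_star_dotProduct_mulVec_self v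
      simpa using this.symm
  have htrBs : ∀ n, (B n * s).trace.re = (N : ℝ)⁻¹ := by
    intro n
    rw [htrB, hb]
    simp only
    rw [mul_assoc, inv_mul_cancel₀ (hpos n).ne', mul_one]
  have hz : (1 - ∑ n, B n) * s = 0 := by
    apply psd_mul_eq_zero hB1 hs
    have hre : ((1 - ∑ n, B n) * s).trace.re = 0 := by
      rw [Matrix.sub_mul, Matrix.one_mul, trace_sub, Finset.sum_mul, trace_sum, Complex.sub_re,
        Complex.re_sum, hs1]
      simp only [htrBs]
      simp [hN'.ne']
    obtain ⟨C, hC⟩ := psd_factor hs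
    have hP := hB1.mul_mul_conjTranspose_same C
    have e : ((1 - ∑ n, B n) * s).trace = (C * (1 - ∑ n, B n) * Cᴴ).trace := by
      rw [hC, ← Matrix.mul_assoc, trace_mul_comm, ← Matrix.mul_assoc]
    rw [e] at hre ⊢
    rw [psd_trace_ofReal hP, hre]
    simp
  have hBs : (∑ n, B n) * s = s := by
    rw [Matrix.sub_mul, Matrix.one_mul, sub_eq_zero] at hz
    exact hz.symm
  have hJ := aux_jensen B hBp (fun n => (M n * s).trace.re / (M n * ρ).trace.re)
    (fun n => div_pos (hpos n) (hρpos n)) s R hs hBs hB1 ?_ hRp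
  · refine le_trans (le_of_eq ?_) hJ
    simp only [htrBs, fobj]
    rw [← mul_sub, ← Finset.sum_sub_distrib, Finset.mul_sum]
    refine Finset.sum_congr rfl fun n _ => ?_
    rw [Real.log_div (hpos n).ne' (hρpos n).ne']
    ring
  · rw [hR, Rmat, Finset.smul_sum]
    refine Finset.sum_congr rfl fun n _ => ?_
    simp only [hB, hb]
    ext i j
    simp only [Matrix.smul_apply, Complex.real_smul, smul_eq_mul, Complex.ofReal_mul, Complex.ofReal_inv,
      Complex.ofReal_div]
    have h1 : (((M n * s).trace.re : ℝ) : ℂ) ≠ 0 := by exact_mod_cast (hpos n).ne'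
    field_simp

lemma aux_step {D : ℕ} (hD : 0 < D) (ρ R τ : Matrix (Fin D) (Fin D) ℂ) (hρ : ρ.PosDef)
    (hR : R.PosDef) (htr : (ρ * R).trace.re = 1)
    (hτ : τ = ((mexp (mlog ρ + mlog R)).trace)⁻¹ • mexp (mlog ρ + mlog R)) :
    τ.PosDef ∧ τ.trace = 1 ∧ ∃ c : ℝ, 0 ≤ c ∧ mlog τ = mlog ρ + mlog R + (c : ℂ) • 1 := by
  have : Nonempty (Fin D) := ⟨⟨0, hD⟩⟩
  have hH : (mlog ρ + mlog R).IsHermitian := (matFun_herm hρ.1 _).add (matFun_herm hR.1 _)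
  have hE := mexp_posDef hH
  have hZ : 0 < (mexp (mlog ρ + mlog R)).trace.re := (Complex.lt_def.1 hE.trace_pos).1
  have hZe := psd_trace_ofReal hE.posSemidef
  set E := mexp (mlog ρ + mlog R) with hEd
  have hτ' : τ = (((E.trace.re)⁻¹ : ℝ) : ℂ) • E := by
    rw [hτ, hZe]; simp
  have hinv := inv_pos.2 hZ
  have hτp : τ.PosDef := by
    rw [hτ']
    exact hE.smul (by exact_mod_cast hinv)
  have hτ1 : τ.trace = 1 := by
    rw [hτ, trace_smul, smul_eq_mul, inv_mul_cancel₀]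
    rw [hZe]
    exact_mod_cast hZ.ne'
  have hlog : mlog τ = mlog ρ + mlog R + (Real.log (E.trace.re)⁻¹ : ℂ) • 1 := by
    rw [hτ', hEd, mlog_smul_mexp hH hinv]
  refine ⟨hτp, hτ1, Real.log (E.trace.re)⁻¹, ?_, hlog⟩
  obtain ⟨W, r, hW1, hW2, hW3, hW4, -, hW6⟩ := aux_spec hR.1
  have hr := hW6 hR
  have hent := aux_entropy τ ρ W hτp hρ hW1 hW2
  have e1 : (τ * mlog τ).trace.re = (τ * mlog ρ).trace.re + (τ * mlog R).trace.re
      + Real.log (E.trace.re)⁻¹ := by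
    conv_lhs => rw [hlog]
    rw [Matrix.mul_add, Matrix.mul_add, trace_add, trace_add, Matrix.mul_smul, Matrix.mul_one,
      trace_smul, hτ1, Complex.add_re, Complex.add_re]
    simp
  have e2 : (τ * mlog R).trace.re = ∑ j, ((Wᴴ * τ * W) j j).re * Real.log (r j) := by
    rw [mlog, hW4, aux_trace_re τ W (fun j => Real.log (r j))]
  have e3 : ∑ j, ((Wᴴ * ρ * W) j j).re * r j = 1 := by
    rw [← htr, ← aux_trace_re ρ W r, ← hW3]
  have e4 : ∑ j, ((Wᴴ * τ * W) j j).re = 1 := by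
    rw [aux_trace_one τ W hW2, hτ1]; simp
  have hWinj : Function.Injective W.mulVec := by
    intro x y hxy
    have := congrArg (fun z => Wᴴ *ᵥ z) hxy
    simpa [mulVec_mulVec, hW1] using this
  have hτj : ∀ j, 0 < ((Wᴴ * τ * W) j j).re := fun j =>
    (Complex.lt_def.1 (hτp.conjTranspose_mul_mul_same hWinj).diag_pos).1
  have hρj : ∀ j, 0 < ((Wᴴ * ρ * W) j j).re := fun j =>
    (Complex.lt_def.1 (hρ.conjTranspose_mul_mul_same hWinj).diag_pos).1
  have hb : ∑ j, ((Wᴴ * τ * W) j j).re *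
        Real.log (((Wᴴ * ρ * W) j j).re / ((Wᴴ * τ * W) j j).re)
      + ∑ j, ((Wᴴ * τ * W) j j).re * Real.log (r j)
      ≤ ∑ j, ((Wᴴ * ρ * W) j j).re * r j - ∑ j, ((Wᴴ * τ * W) j j).re := by
    rw [← Finset.sum_add_distrib, ← Finset.sum_sub_distrib]
    refine Finset.sum_le_sum fun j _ => ?_
    have h1 := hτj j
    have h2 := hρj j
    have h3 := hr j
    generalize ((Wᴴ * τ * W) j j).re = u at *
    generalize ((Wᴴ * ρ * W) j j).re = v at *
    rw [← mul_add, ← Real.log_mul (by positivity) h3.ne']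
    have h4 := mul_le_mul_of_nonneg_left
      (Real.log_le_sub_one_of_pos (show 0 < v / u * r j by positivity)) h1.le
    refine h4.trans (le_of_eq ?_)
    field_simp
  linarith

lemma aux_R_trace {D N : ℕ} (M : Fin N → Matrix (Fin D) (Fin D) ℂ)
    (ρ : Matrix (Fin D) (Fin D) ℂ) (hN : 0 < N) (hpos : ∀ n, 0 < (M n * ρ).trace.re) :
    (ρ * Rmat M ρ).trace.re = 1 := by
  have hN' : (N : ℝ) ≠ 0 := by exact_mod_cast hN.ne'
  rw [trace_mul_comm, Rmat, Matrix.smul_mul, Finset.sum_mul, trace_smul, trace_sum,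
    Complex.smul_re, Complex.re_sum]
  have : ∀ n, (((M n * ρ).trace.re)⁻¹ • M n * ρ).trace.re = 1 := by
    intro n
    rw [Matrix.smul_mul, trace_smul, Complex.smul_re, smul_eq_mul, inv_mul_cancel₀ (hpos n).ne']
  simp only [this]
  simp [hN']

lemma aux_R_posDef {D N : ℕ} (M : Fin N → Matrix (Fin D) (Fin D) ℂ)
    (hM : ∀ n, (M n).PosSemidef)
    (hker : ∀ v : Fin D → ℂ, (∀ n, (M n) *ᵥ v = 0) → v = 0)
    (ρ : Matrix (Fin D) (Fin D) ℂ) (hN : 0 < N) (hpos : ∀ n, 0 < (M n * ρ).trace.re) :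
    (Rmat M ρ).PosDef := by
  have hN' : (0 : ℝ) < N := by exact_mod_cast hN
  have hps : (Rmat M ρ).PosSemidef :=
    (posSemidef_sum _ fun n _ => (hM n).smul (inv_nonneg.2 (hpos n).le)).smul
      (inv_nonneg.2 hN'.le)
  refine PosDef.of_dotProduct_mulVec_pos hps.1 fun {x} hx => ?_
  refine lt_of_le_of_ne (hps.dotProduct_mulVec_nonneg x) fun h0 => hx (hker x fun n => ?_)
  rw [← (hM n).dotProduct_mulVec_zero_iff x]
  have h1 : star x ⬝ᵥ (Rmat M ρ *ᵥ x)
      = (N : ℝ)⁻¹ • ∑ n, ((M n * ρ).trace.re)⁻¹ • (star x ⬝ᵥ (M n *ᵥ x)) := by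
    rw [Rmat, Matrix.smul_mulVec, Matrix.sum_mulVec, dotProduct_smul, dotProduct_sum]
    simp only [Matrix.smul_mulVec, dotProduct_smul]
  rw [h1] at h0
  have h2 : ∑ n, ((M n * ρ).trace.re)⁻¹ • (star x ⬝ᵥ (M n *ᵥ x)) = 0 := by
    rcases smul_eq_zero.1 h0.symm with h | h
    · exact absurd h (inv_pos.2 hN').ne'
    · exact h
  rw [Finset.sum_eq_zero_iff_of_nonneg (fun n _ =>
    smul_nonneg (inv_nonneg.2 (hpos n).le) ((hM n).dotProduct_mulVec_nonneg x))] at h2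
  rcases smul_eq_zero.1 (h2 n (Finset.mem_univ n)) with h | h
  · exact absurd h (inv_pos.2 (hpos n)).ne'
  · exact h

lemma aux_log_nonpos {D : ℕ} (s ρ : Matrix (Fin D) (Fin D) ℂ) (hs : s.PosSemidef)
    (hρ : ρ.PosDef) (hρ1 : ρ.trace = 1) : (s * mlog ρ).trace.re ≤ 0 := by
  obtain ⟨U, l, h1, h2, h3, h4, -, h6⟩ := aux_spec hρ.1
  have hl := h6 hρ
  rw [mlog, h4, aux_trace_re s U (fun j => Real.log (l j))]
  have hsum : ∑ j, l j = 1 := by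
    have e := aux_trace_re 1 U l
    rw [← h3, Matrix.one_mul, hρ1, Matrix.mul_one, h1] at e
    simpa using e.symm
  refine Finset.sum_nonpos fun j _ => mul_nonpos_of_nonneg_of_nonpos ?_ ?_
  · exact (Complex.le_def.1 (hs.conjTranspose_mul_mul_same U).diag_nonneg).1
  · refine Real.log_nonpos (hl j).le ?_
    rw [← hsum]
    exact Finset.single_le_sum (f := l) (fun i _ => (hl i).le) (Finset.mem_univ j)

lemma mlog_init {D : ℕ} (hD : 0 < D) :
    mlog ((D : ℂ)⁻¹ • (1 : Matrix (Fin D) (Fin D) ℂ)) = ((-Real.log D : ℝ) : ℂ) • 1 := by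
  have hD' : (0 : ℝ) < D := by exact_mod_cast hD
  have hz : (0 : Matrix (Fin D) (Fin D) ℂ).IsHermitian := isHermitian_zero
  have h1 : mexp (0 : Matrix (Fin D) (Fin D) ℂ) = 1 := by
    rw [mexp, matFun_eq_cfc hz, cfc_apply_zero]
    simp
  have h := mlog_smul_mexp hz (inv_pos.2 hD')
  rw [h1, Real.log_inv, zero_add] at h
  rw [← h]
  simp

lemma aux_convex {D N : ℕ} (M : Fin N → Matrix (Fin D) (Fin D) ℂ)
    (ρ : ℕ → Matrix (Fin D) (Fin D) ℂ) (hpos : ∀ i n, 0 < (M n * ρ i).trace.re)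
    (k : ℕ) (hk : 0 < k) :
    fobj M ((k : ℂ)⁻¹ • ∑ i ∈ Finset.range k, ρ i)
      ≤ (k : ℝ)⁻¹ * ∑ i ∈ Finset.range k, fobj M (ρ i) := by
  have hk' : (0 : ℝ) < k := by exact_mod_cast hk
  simp only [fobj]
  rw [← Finset.mul_sum, Finset.sum_comm, mul_left_comm]
  refine mul_le_mul_of_nonneg_left ?_ (by positivity)
  rw [Finset.mul_sum]
  refine Finset.sum_le_sum fun n _ => ?_
  have e : (M n * ((k : ℂ)⁻¹ • ∑ i ∈ Finset.range k, ρ i)).trace.re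
      = ∑ i ∈ Finset.range k, (k : ℝ)⁻¹ • (M n * ρ i).trace.re := by
    rw [Matrix.mul_smul, trace_smul, Finset.mul_sum, trace_sum, ← Finset.smul_sum, smul_eq_mul,
      smul_eq_mul]
    have : ((k : ℂ)⁻¹) = (((k : ℝ)⁻¹ : ℝ) : ℂ) := by simp
    rw [this, Complex.re_ofReal_mul, Complex.re_sum]
  have h := strictConcaveOn_log_Ioi.concaveOn.le_map_sum (t := Finset.range k)
    (w := fun _ => (k : ℝ)⁻¹) (p := fun i => (M n * ρ i).trace.re)
    (fun _ _ => by positivity) (by simp [hk'.ne']) (fun i _ => hpos i n)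
  rw [e]
  simp only [smul_eq_mul, Finset.sum_neg_distrib, ← Finset.mul_sum] at h ⊢
  linarith

/-- Theorem 1 of the paper: iteration complexity of the proposed algorithm. -/
theorem stmt0 {D N : ℕ} (hD : 0 < D) (hN : 0 < N)
    (M : Fin N → Matrix (Fin D) (Fin D) ℂ)
    (hM : ∀ n, (M n).PosSemidef) (hMne : ∀ n, M n ≠ 0)
    (hker : ∀ v : Fin D → ℂ, (∀ n, (M n) *ᵥ v = 0) → v = 0)
    (ρ : ℕ → Matrix (Fin D) (Fin D) ℂ)
    (h0 : ρ 0 = (D : ℂ)⁻¹ • 1)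
    (hstep : ∀ k, ρ (k + 1) =
      ((mexp (mlog (ρ k) + mlog (Rmat M (ρ k)))).trace)⁻¹ •
        mexp (mlog (ρ k) + mlog (Rmat M (ρ k))))
    (ρbar : ℕ → Matrix (Fin D) (Fin D) ℂ)
    (hbar : ∀ k, ρbar k = (k : ℂ)⁻¹ • ∑ i ∈ Finset.range k, ρ i)
    (σ : Matrix (Fin D) (Fin D) ℂ)
    (hσ : σ.PosSemidef) (hσtr : σ.trace = 1)
    (hσpos : ∀ n, 0 < (M n * σ).trace.re) :
    (∀ k : ℕ, 0 < k → fobj M (ρbar k) - fobj M σ ≤ Real.log D / k) ∧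
    (∀ ε : ℝ, 0 < ε → ∀ k : ℕ, 0 < k → (1 / ε) * Real.log D ≤ (k : ℝ) →
      fobj M (ρbar k) - fobj M σ ≤ ε) := by
  have hN' : (0 : ℝ) < N := by exact_mod_cast hN
  have hD' : (0 : ℝ) < D := by exact_mod_cast hD
  obtain ⟨s, hs, hs1, hmax⟩ := aux_max M σ hσ hσtr
  have hσs := hmax σ hσ hσtr
  have hprod : 0 < ∏ n, (M n * s).trace.re :=
    lt_of_lt_of_le (Finset.prod_pos fun n _ => hσpos n) hσs
  have hspos : ∀ n, 0 < (M n * s).trace.re := fun n =>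
    lt_of_le_of_ne (psd_trace_mul (hM n) hs) fun h =>
      hprod.ne' (Finset.prod_eq_zero (Finset.mem_univ n) h.symm)
  have hfs : fobj M s ≤ fobj M σ := by
    simp only [fobj]
    refine mul_le_mul_of_nonneg_left ?_ (inv_nonneg.2 hN'.le)
    rw [Finset.sum_neg_distrib, Finset.sum_neg_distrib,
      ← Real.log_prod (fun n _ => (hspos n).ne'), ← Real.log_prod (fun n _ => (hσpos n).ne')]
    exact neg_le_neg (Real.log_le_log (Finset.prod_pos fun n _ => hσpos n) hσs)
  have hposOf : ∀ τ : Matrix (Fin D) (Fin D) ℂ, τ.PosDef → ∀ n, 0 < (M n * τ).trace.re :=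
    fun τ hτ n => psd_trace_mul_pos (hM n) (hMne n) hτ
  have hρ : ∀ k, (ρ k).PosDef ∧ (ρ k).trace = 1 := by
    intro k
    induction k with
    | zero =>
      rw [h0]
      constructor
      · have h1 : (1 : Matrix (Fin D) (Fin D) ℂ).PosDef := PosDef.one
        have h2 : (0 : ℂ) < (D : ℂ)⁻¹ := by
          have : (D : ℂ)⁻¹ = (((D : ℝ)⁻¹ : ℝ) : ℂ) := by simp
          rw [this]
          exact_mod_cast inv_pos.2 hD'
        exact h1.smul h2
      · rw [trace_smul, trace_one, Fintype.card_fin, smul_eq_mul, inv_mul_cancel₀]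
        exact_mod_cast hD.ne'
    | succ k ih =>
      have hp := hposOf _ ih.1
      obtain ⟨h1, h2, -⟩ := aux_step hD (ρ k) (Rmat M (ρ k)) (ρ (k + 1)) ih.1
        (aux_R_posDef M hM hker _ hN hp) (aux_R_trace M _ hN hp) (hstep k)
      exact ⟨h1, h2⟩
  have hp : ∀ i n, 0 < (M n * ρ i).trace.re := fun i => hposOf _ (hρ i).1
  have hRp : ∀ i, (Rmat M (ρ i)).PosDef := fun i => aux_R_posDef M hM hker _ hN (hp i)
  have htel : ∀ k, -Real.log D + ∑ i ∈ Finset.range k, (s * mlog (Rmat M (ρ i))).trace.re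
      ≤ (s * mlog (ρ k)).trace.re := by
    intro k
    induction k with
    | zero =>
      rw [h0, mlog_init hD, Matrix.mul_smul, Matrix.mul_one, trace_smul, hs1, smul_eq_mul, mul_one,
        Complex.ofReal_re, Finset.sum_range_zero, add_zero]
    | succ k ih =>
      obtain ⟨-, -, c, hc, hlog⟩ := aux_step hD (ρ k) (Rmat M (ρ k)) (ρ (k + 1)) (hρ k).1
        (hRp k) (aux_R_trace M _ hN (hp k)) (hstep k)
      rw [hlog, Matrix.mul_add, Matrix.mul_add, trace_add, trace_add, Matrix.mul_smul,
        Matrix.mul_one, trace_smul, hs1, Complex.add_re, Complex.add_re, Finset.sum_range_succ]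
      simp only [smul_eq_mul, mul_one, Complex.ofReal_re]
      linarith
  have main : ∀ k : ℕ, 0 < k → fobj M (ρbar k) - fobj M σ ≤ Real.log D / k := by
    intro k hk
    have hk' : (0 : ℝ) < k := by exact_mod_cast hk
    have h1 := aux_convex M ρ hp k hk
    rw [← hbar] at h1
    have h2 : ∑ i ∈ Finset.range k, (fobj M (ρ i) - fobj M s)
        ≤ ∑ i ∈ Finset.range k, (s * mlog (Rmat M (ρ i))).trace.re :=
      Finset.sum_le_sum fun i _ =>
        aux_B hN M hM s hs hs1 hspos hmax _ (ρ i) rfl (hRp i) (hp i)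
    have h3 := htel k
    have h4 := aux_log_nonpos s (ρ k) hs (hρ k).1 (hρ k).2
    rw [Finset.sum_sub_distrib, Finset.sum_const, Finset.card_range, nsmul_eq_mul] at h2
    have h5 : ∑ i ∈ Finset.range k, fobj M (ρ i) ≤ Real.log D + k * fobj M s := by linarith
    have h6 := mul_le_mul_of_nonneg_left h5 (inv_nonneg.2 hk'.le)
    rw [mul_add, ← mul_assoc, inv_mul_cancel₀ hk'.ne', one_mul] at h6
    rw [div_eq_inv_mul]
    linarith
  refine ⟨main, fun ε hε k hk hle => (main k hk).trans ?_⟩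
  have hk' : (0 : ℝ) < k := by exact_mod_cast hk
  rw [div_le_iff₀ hk']
  rw [one_div, inv_mul_le_iff₀ hε] at hle
  exact hle
end

section
/- For every density matrix σ, the function φ(ρ) := tr(σ · log R(ρ)) is convex on the convex set of Hermitian positive semi-definite D×D matrices ρ satisfying tr(M_n ρ) > 0 for all n. That is, for ρ₀, ρ₁ in this set and t ∈ [0,1], tr(σ · log R((1−t)ρ₀ + tρ₁)) ≤ (1−t)·tr(σ · log R(ρ₀)) + t·tr(σ · log R(ρ₁)). -/
open Matrix
open scoped ComplexOrder

/-- The real linear functional `X ↦ Re tr(σ X)`. -/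
noncomputable def Lfun {D : ℕ} (σ X : Matrix (Fin D) (Fin D) ℂ) : ℝ := (σ * X).trace.re

lemma Lfun_add {D : ℕ} (σ X Y : Matrix (Fin D) (Fin D) ℂ) :
    Lfun σ (X + Y) = Lfun σ X + Lfun σ Y := by
  simp [Lfun, mul_add]

lemma Lfun_sub {D : ℕ} (σ X Y : Matrix (Fin D) (Fin D) ℂ) :
    Lfun σ (X - Y) = Lfun σ X - Lfun σ Y := by
  simp [Lfun, mul_sub]

lemma Lfun_smul {D : ℕ} (σ X : Matrix (Fin D) (Fin D) ℂ) (c : ℝ) :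
    Lfun σ (c • X) = c * Lfun σ X := by
  simp [Lfun]

lemma Lfun_sum {D N : ℕ} (σ : Matrix (Fin D) (Fin D) ℂ) (X : Fin N → Matrix (Fin D) (Fin D) ℂ) :
    Lfun σ (∑ n, X n) = ∑ n, Lfun σ (X n) := by
  simp [Lfun, Finset.mul_sum, Matrix.trace_sum]

open scoped MatrixOrder in
lemma Lfun_nonneg {D : ℕ} {σ X : Matrix (Fin D) (Fin D) ℂ} (hσ : σ.PosSemidef)
    (hX : X.PosSemidef) : 0 ≤ Lfun σ X := by
  obtain ⟨B, rfl⟩ := CStarAlgebra.nonneg_iff_eq_star_mul_self.mp hX.nonneg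
  rw [star_eq_conjTranspose] at *
  have h := (hσ.mul_mul_conjTranspose_same B).trace_nonneg
  unfold Lfun
  rw [← mul_assoc, Matrix.trace_mul_comm, ← mul_assoc]
  exact (Complex.nonneg_iff.mp h).1

lemma Lfun_matFun {D : ℕ} (σ A : Matrix (Fin D) (Fin D) ℂ) (hA : A.IsHermitian) :
    ∃ w : Fin D → ℝ, (∑ i, w i = σ.trace.re) ∧
      ∀ g : ℝ → ℝ, Lfun σ (matFun g A) = ∑ i, w i * g (hA.eigenvalues i) := by
  have hU : (hA.eigenvectorUnitary : Matrix (Fin D) (Fin D) ℂ) *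
      star (hA.eigenvectorUnitary : Matrix (Fin D) (Fin D) ℂ) = 1 :=
    Unitary.mul_star_self_of_mem hA.eigenvectorUnitary.2
  set U := (hA.eigenvectorUnitary : Matrix (Fin D) (Fin D) ℂ) with hUdef
  refine ⟨fun i => ((star U * σ * U) i i).re, ?_, ?_⟩
  · have : (star U * σ * U).trace = σ.trace := by
      rw [Matrix.trace_mul_comm, ← mul_assoc, hU, one_mul]
    rw [← this, Matrix.trace, Complex.re_sum]; rfl
  · intro g
    have : (σ * matFun g A).trace =
        ((star U * σ * U) * Matrix.diagonal (fun i => (g (hA.eigenvalues i) : ℂ))).trace := by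
      rw [matFun, dif_pos hA, ← hUdef, ← mul_assoc, Matrix.trace_mul_comm]
      simp only [mul_assoc]
    rw [Lfun, this, Matrix.trace, Complex.re_sum]
    refine Finset.sum_congr rfl fun i _ => ?_
    simp [Matrix.diag, Matrix.mul_diagonal]

lemma mat_resolvent {D : ℕ} (A : Matrix (Fin D) (Fin D) ℂ) (hA : A.PosDef) (T : ℝ) (hT : 0 ≤ T) :
    ∃ P : Matrix (Fin D) (Fin D) ℂ, P = matFun (fun x => (x + T)⁻¹) A ∧ P.IsHermitian ∧
      P * (A + T • 1) = 1 ∧ (A + T • 1) * P = 1 := by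
  have hH := hA.isHermitian
  have hU : (hH.eigenvectorUnitary : Matrix (Fin D) (Fin D) ℂ) *
      star (hH.eigenvectorUnitary : Matrix (Fin D) (Fin D) ℂ) = 1 :=
    Unitary.mul_star_self_of_mem hH.eigenvectorUnitary.2
  have hU' : star (hH.eigenvectorUnitary : Matrix (Fin D) (Fin D) ℂ) *
      (hH.eigenvectorUnitary : Matrix (Fin D) (Fin D) ℂ) = 1 :=
    Unitary.star_mul_self_of_mem hH.eigenvectorUnitary.2
  have hspec : A = (hH.eigenvectorUnitary : Matrix (Fin D) (Fin D) ℂ) *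
      Matrix.diagonal (fun i => (hH.eigenvalues i : ℂ)) *
      star (hH.eigenvectorUnitary : Matrix (Fin D) (Fin D) ℂ) := by
    have := hH.spectral_theorem
    rw [Unitary.conjStarAlgAut_apply] at this
    exact this
  have hpos := hA.eigenvalues_pos
  have hmf : matFun (fun x => (x + T)⁻¹) A = (hH.eigenvectorUnitary : Matrix (Fin D) (Fin D) ℂ) *
      Matrix.diagonal (fun i => (((hH.eigenvalues i + T)⁻¹ : ℝ) : ℂ)) *
      star (hH.eigenvectorUnitary : Matrix (Fin D) (Fin D) ℂ) := by
    rw [matFun, dif_pos hH]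
  generalize (hH.eigenvectorUnitary : Matrix (Fin D) (Fin D) ℂ) = U at *
  have hspec2 : A + T • 1 = U * Matrix.diagonal (fun i => ((hH.eigenvalues i + T : ℝ) : ℂ)) *
      star U := by
    have : Matrix.diagonal (fun i => ((hH.eigenvalues i + T : ℝ) : ℂ)) =
      Matrix.diagonal (fun i => (hH.eigenvalues i : ℂ)) + T • (1 : Matrix (Fin D) (Fin D) ℂ) := by
      ext i j
      by_cases h : i = j
      · subst h; simp
      · simp [h]
    rw [this, mul_add, add_mul, ← hspec]
    simp [hU]
  have hprod : ∀ d e : Fin D → ℂ, (∀ i, d i * e i = 1) →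
      (U * Matrix.diagonal d * star U) * (U * Matrix.diagonal e * star U) = 1 := by
    intro d e h
    have : (U * Matrix.diagonal d * star U) * (U * Matrix.diagonal e * star U)
      = U * (Matrix.diagonal d * (star U * U) * Matrix.diagonal e) * star U := by
      simp only [mul_assoc]
    rw [this, hU', mul_one, Matrix.diagonal_mul_diagonal]
    simp [h, hU]
  have hne : ∀ i, hH.eigenvalues i + T ≠ 0 := fun i => by have := hpos i; positivity
  refine ⟨_, rfl, ?_, ?_, ?_⟩
  · rw [hmf, Matrix.IsHermitian, ← star_eq_conjTranspose, star_mul, star_mul, star_star,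
      star_eq_conjTranspose (Matrix.diagonal _), Matrix.diagonal_conjTranspose, mul_assoc]
    congr 3
    ext i
    simp
  · rw [hmf, hspec2]
    refine hprod _ _ fun i => ?_
    rw [← Complex.ofReal_mul, inv_mul_cancel₀ (hne i), Complex.ofReal_one]
  · rw [hmf, hspec2]
    refine hprod _ _ fun i => ?_
    rw [← Complex.ofReal_mul, mul_inv_cancel₀ (hne i), Complex.ofReal_one]

/-- `S(a) = ∑ₙ aₙ⁻¹ Mₙ`. -/
noncomputable def Smat {D N : ℕ} (M : Fin N → Matrix (Fin D) (Fin D) ℂ) (a : Fin N → ℝ) :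
    Matrix (Fin D) (Fin D) ℂ := (N : ℝ)⁻¹ • ∑ n, ((a n)⁻¹ • M n)

lemma key_one {D N : ℕ} (M : Fin N → Matrix (Fin D) (Fin D) ℂ) (hM : ∀ n, (M n).PosSemidef)
    (σ : Matrix (Fin D) (Fin D) ℂ) (hσ : σ.PosSemidef) (a b : Fin N → ℝ)
    (ha : ∀ n, 0 < a n) (T : ℝ) (hT : 0 ≤ T)
    (P Q : Matrix (Fin D) (Fin D) ℂ) (hP : P.IsHermitian) (hQ : Q.IsHermitian)
    (hP1 : P * (Smat M b + T • 1) = 1) (hP2 : (Smat M b + T • 1) * P = 1)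
    (hQ1 : Q * (Smat M a + T • 1) = 1) :
    Lfun σ Q ≤ Lfun σ (P * ((N : ℝ)⁻¹ • ∑ n, ((a n * (b n)⁻¹ ^ 2) • M n) + T • 1) * P) := by
  have h1 : ∀ n, (((N : ℝ)⁻¹ * a n) • (((b n)⁻¹ • P - (a n)⁻¹ • Q) * M n *
      ((b n)⁻¹ • P - (a n)⁻¹ • Q))).PosSemidef := by
    intro n
    have hK : ((b n)⁻¹ • P - (a n)⁻¹ • Q)ᴴ = ((b n)⁻¹ • P - (a n)⁻¹ • Q) := by
      simp [Matrix.conjTranspose_smul, hP.eq, hQ.eq]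
    have := (hM n).mul_mul_conjTranspose_same ((b n)⁻¹ • P - (a n)⁻¹ • Q)
    rw [hK] at this
    exact this.smul (by have := ha n; positivity)
  have h2 : (T • ((P - Q) * (P - Q))).PosSemidef := by
    have hK : (P - Q)ᴴ = P - Q := by simp [hP.eq, hQ.eq]
    have := Matrix.posSemidef_conjTranspose_mul_self (P - Q)
    rw [hK] at this
    exact this.smul hT
  have h3 : P * ((N : ℝ)⁻¹ • ∑ n, ((a n * (b n)⁻¹ ^ 2) • M n) + T • 1) * P - Q =
      (∑ n, ((N : ℝ)⁻¹ * a n) • (((b n)⁻¹ • P - (a n)⁻¹ • Q) * M n *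
      ((b n)⁻¹ • P - (a n)⁻¹ • Q))) + T • ((P - Q) * (P - Q)) := by
    have e1 : P * (Smat M b + T • 1) * Q = Q := by rw [hP1, one_mul]
    have e2 : Q * (Smat M b + T • 1) * P = Q := by rw [mul_assoc, hP2, mul_one]
    have e3 : Q * (Smat M a + T • 1) * Q = Q := by rw [hQ1, one_mul]
    have e4 : ∀ n, ((N : ℝ)⁻¹ * a n) • (((b n)⁻¹ • P - (a n)⁻¹ • Q) * M n *
      ((b n)⁻¹ • P - (a n)⁻¹ • Q)) =
        P * ((N : ℝ)⁻¹ • ((a n * (b n)⁻¹ ^ 2) • M n)) * P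
        - P * ((N : ℝ)⁻¹ • ((b n)⁻¹ • M n)) * Q - Q * ((N : ℝ)⁻¹ • ((b n)⁻¹ • M n)) * P
        + Q * ((N : ℝ)⁻¹ • ((a n)⁻¹ • M n)) * Q := by
      intro n
      have := (ha n).ne'
      simp only [sub_mul, mul_sub, smul_mul_assoc, mul_smul_comm, smul_sub, smul_smul]
      have c1 : (N : ℝ)⁻¹ * a n * ((b n)⁻¹ * (b n)⁻¹) = (N : ℝ)⁻¹ * (a n * (b n)⁻¹ ^ 2) := by ring
      have c2 : (N : ℝ)⁻¹ * a n * ((a n)⁻¹ * (b n)⁻¹) = (N : ℝ)⁻¹ * (b n)⁻¹ := by field_simp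
      have c3 : (N : ℝ)⁻¹ * a n * ((b n)⁻¹ * (a n)⁻¹) = (N : ℝ)⁻¹ * (b n)⁻¹ := by field_simp
      have c4 : (N : ℝ)⁻¹ * a n * ((a n)⁻¹ * (a n)⁻¹) = (N : ℝ)⁻¹ * (a n)⁻¹ := by field_simp
      rw [c1, c2, c3, c4]
      abel
    simp only [e4, Finset.sum_add_distrib, Finset.sum_sub_distrib, ← Finset.mul_sum,
      ← Finset.sum_mul, ← Finset.smul_sum]
    change _ = P * _ * P - P * Smat M b * Q - Q * Smat M b * P + Q * Smat M a * Q + _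
    simp only [mul_add, add_mul, mul_smul_comm, smul_mul_assoc, mul_one] at e1 e2 e3 ⊢
    simp only [sub_mul, mul_sub, smul_sub]
    rw [eq_sub_of_add_eq e1, eq_sub_of_add_eq e2, eq_sub_of_add_eq e3]
    abel
  have h4 : 0 ≤ Lfun σ (P * ((N : ℝ)⁻¹ • ∑ n, ((a n * (b n)⁻¹ ^ 2) • M n) + T • 1) * P - Q) := by
    rw [h3, Lfun_add, Lfun_sum]
    exact add_nonneg (Finset.sum_nonneg fun n _ => Lfun_nonneg hσ (h1 n)) (Lfun_nonneg hσ h2)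
  rw [Lfun_sub] at h4
  linarith

lemma Smat_posDef {D N : ℕ} (hN : 0 < N) (M : Fin N → Matrix (Fin D) (Fin D) ℂ)
    (hM : ∀ n, (M n).PosSemidef)
    (hker : ∀ v : Fin D → ℂ, (∀ n, (M n) *ᵥ v = 0) → v = 0) (a : Fin N → ℝ)
    (ha : ∀ n, 0 < a n) : (Smat M a).PosDef := by
  have hN' : (0 : ℝ) < (N : ℝ)⁻¹ := by positivity
  have hS : (∑ n, ((a n)⁻¹ • M n)).PosSemidef :=
    Matrix.posSemidef_sum _ fun n _ => (hM n).smul (inv_nonneg.mpr (ha n).le)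
  refine Matrix.PosDef.smul ?_ hN'
  refine Matrix.PosDef.of_dotProduct_mulVec_pos hS.isHermitian fun v hv => ?_
  have hq : ∀ n, 0 ≤ star v ⬝ᵥ (((a n)⁻¹ • M n) *ᵥ v) := fun n =>
    ((hM n).smul (inv_nonneg.mpr (ha n).le)).dotProduct_mulVec_nonneg v
  have hsum : star v ⬝ᵥ ((∑ n, ((a n)⁻¹ • M n)) *ᵥ v) =
      ∑ n, star v ⬝ᵥ (((a n)⁻¹ • M n) *ᵥ v) := by
    rw [Matrix.sum_mulVec, dotProduct_sum]
  rw [hsum]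
  refine lt_of_le_of_ne (Finset.sum_nonneg fun n _ => hq n) fun h0 => hv (hker v fun n => ?_)
  have h1 := (Finset.sum_eq_zero_iff_of_nonneg (fun n _ => hq n)).mp h0.symm n (Finset.mem_univ n)
  rw [((hM n).smul (inv_nonneg.mpr (ha n).le)).dotProduct_mulVec_zero_iff, Matrix.smul_mulVec] at h1
  exact (smul_eq_zero.mp h1).resolve_left (inv_pos.mpr (ha n)).ne'

lemma key_two {D N : ℕ} (hN : 0 < N) (M : Fin N → Matrix (Fin D) (Fin D) ℂ)
    (hM : ∀ n, (M n).PosSemidef)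
    (hker : ∀ v : Fin D → ℂ, (∀ n, (M n) *ᵥ v = 0) → v = 0)
    (σ : Matrix (Fin D) (Fin D) ℂ) (hσ : σ.PosSemidef) (a₀ a₁ b : Fin N → ℝ)
    (ha₀ : ∀ n, 0 < a₀ n) (ha₁ : ∀ n, 0 < a₁ n) (hb : ∀ n, 0 < b n) (t : ℝ)
    (ht0 : 0 ≤ t) (ht1 : t ≤ 1) (hbt : ∀ n, b n = (1 - t) * a₀ n + t * a₁ n)
    (T : ℝ) (hT : 0 ≤ T) :
    (1 - t) * Lfun σ (matFun (fun x => (x + T)⁻¹) (Smat M a₀)) +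
      t * Lfun σ (matFun (fun x => (x + T)⁻¹) (Smat M a₁)) ≤
      Lfun σ (matFun (fun x => (x + T)⁻¹) (Smat M b)) := by
  obtain ⟨Q₀, e0, hQ₀, hQ₀1, -⟩ := mat_resolvent _ (Smat_posDef hN M hM hker a₀ ha₀) T hT
  obtain ⟨Q₁, e1, hQ₁, hQ₁1, -⟩ := mat_resolvent _ (Smat_posDef hN M hM hker a₁ ha₁) T hT
  obtain ⟨P, e2, hP, hP1, hP2⟩ := mat_resolvent _ (Smat_posDef hN M hM hker b hb) T hT
  rw [← e0, ← e1, ← e2]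
  have k0 := key_one M hM σ hσ a₀ b ha₀ T hT P Q₀ hP hQ₀ hP1 hP2 hQ₀1
  have k1 := key_one M hM σ hσ a₁ b ha₁ T hT P Q₁ hP hQ₁ hP1 hP2 hQ₁1
  have hPP : P = (1 - t) • (P * ((N : ℝ)⁻¹ • ∑ n, ((a₀ n * (b n)⁻¹ ^ 2) • M n) + T • 1) * P) +
      t • (P * ((N : ℝ)⁻¹ • ∑ n, ((a₁ n * (b n)⁻¹ ^ 2) • M n) + T • 1) * P) := by
    have : Smat M b + T • 1 = (1 - t) • ((N : ℝ)⁻¹ • ∑ n, ((a₀ n * (b n)⁻¹ ^ 2) • M n) + T • 1) +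
      t • ((N : ℝ)⁻¹ • ∑ n, ((a₁ n * (b n)⁻¹ ^ 2) • M n) + T • 1) := by
      have h1 : Smat M b = (1 - t) • ((N : ℝ)⁻¹ • ∑ n, ((a₀ n * (b n)⁻¹ ^ 2) • M n)) +
          t • ((N : ℝ)⁻¹ • ∑ n, ((a₁ n * (b n)⁻¹ ^ 2) • M n)) := by
        simp only [Smat, Finset.smul_sum, ← Finset.sum_add_distrib, smul_smul, ← add_smul]
        refine Finset.sum_congr rfl fun n _ => ?_
        congr 1
        have h2 : (b n)⁻¹ = b n * (b n)⁻¹ ^ 2 := by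
          have := (hb n).ne'
          field_simp
        calc (N : ℝ)⁻¹ * (b n)⁻¹ = (N : ℝ)⁻¹ * (b n * (b n)⁻¹ ^ 2) := by rw [← h2]
          _ = (N : ℝ)⁻¹ * (((1 - t) * a₀ n + t * a₁ n) * (b n)⁻¹ ^ 2) := by rw [← hbt]
          _ = _ := by ring
      rw [h1]
      module
    have h3 : ∀ X Y : Matrix (Fin D) (Fin D) ℂ, (1 - t) • (P * X * P) + t • (P * Y * P) =
        P * ((1 - t) • X + t • Y) * P := by
      intro X Y
      simp only [mul_add, add_mul, mul_smul_comm, smul_mul_assoc]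
    rw [h3, ← this, hP1, one_mul]
  have hL := congrArg (Lfun σ) hPP
  rw [Lfun_add, Lfun_smul, Lfun_smul] at hL
  have := mul_le_mul_of_nonneg_left k0 (sub_nonneg.mpr ht1)
  have := mul_le_mul_of_nonneg_left k1 ht0
  linarith

lemma sum_log_deriv {D : ℕ} (w l : Fin D → ℝ) (hl : ∀ i, 0 < l i) (T : ℝ) (hT : 0 ≤ T) :
    HasDerivAt (fun T => ∑ i, w i * Real.log (l i + T)) (∑ i, w i * (l i + T)⁻¹) T := by
  refine HasDerivAt.fun_sum fun i _ => ?_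
  have h : l i + T ≠ 0 := by have := hl i; positivity
  have := (((hasDerivAt_id T).const_add (l i)).log h).const_mul (w i)
  simpa using this

lemma sum_log_lim {D : ℕ} (w l : Fin D → ℝ) (hw : ∑ i, w i = 1) :
    Filter.Tendsto (fun T => ∑ i, w i * Real.log (l i + T) - Real.log T) Filter.atTop
      (nhds 0) := by
  have h : ∀ T, ∑ i, w i * Real.log (l i + T) - Real.log T =
      ∑ i, w i * (Real.log (T + l i) - Real.log T) := by
    intro T
    simp only [mul_sub, Finset.sum_sub_distrib, ← Finset.sum_mul, hw, one_mul, add_comm]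
  simp only [h]
  have := tendsto_finsetSum Finset.univ fun i (_ : i ∈ Finset.univ) =>
    (Real.tendsto_log_comp_add_sub_log (l i)).const_mul (w i)
  simpa using this

/-- Lemma 2 (operator log-convexity): `ρ ↦ tr(σ log R(ρ))` is convex. -/
theorem stmt4 {D N : ℕ} (hD : 0 < D) (hN : 0 < N)
    (M : Fin N → Matrix (Fin D) (Fin D) ℂ)
    (hM : ∀ n, (M n).PosSemidef) (hMne : ∀ n, M n ≠ 0)
    (hker : ∀ v : Fin D → ℂ, (∀ n, (M n) *ᵥ v = 0) → v = 0)
    (σ : Matrix (Fin D) (Fin D) ℂ) (hσ : σ.PosSemidef) (hσtr : σ.trace = 1)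
    (ρ₀ ρ₁ : Matrix (Fin D) (Fin D) ℂ)
    (hρ₀ : ρ₀.PosSemidef) (hρ₀pos : ∀ n, 0 < (M n * ρ₀).trace.re)
    (hρ₁ : ρ₁.PosSemidef) (hρ₁pos : ∀ n, 0 < (M n * ρ₁).trace.re)
    (t : ℝ) (ht0 : 0 ≤ t) (ht1 : t ≤ 1) :
    ((σ * mlog (Rmat M ((1 - t) • ρ₀ + t • ρ₁))).trace).re ≤
      (1 - t) * ((σ * mlog (Rmat M ρ₀)).trace).re +
        t * ((σ * mlog (Rmat M ρ₁)).trace).re := by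
  set a₀ : Fin N → ℝ := fun n => (M n * ρ₀).trace.re with ha₀
  set a₁ : Fin N → ℝ := fun n => (M n * ρ₁).trace.re with ha₁
  set b : Fin N → ℝ := fun n => (M n * ((1 - t) • ρ₀ + t • ρ₁)).trace.re with hb
  have hbt : ∀ n, b n = (1 - t) * a₀ n + t * a₁ n := by
    intro n
    change Lfun (M n) _ = (1 - t) * Lfun (M n) _ + t * Lfun (M n) _
    rw [Lfun_add, Lfun_smul, Lfun_smul]
  have hbpos : ∀ n, 0 < b n := by
    intro n
    rw [hbt]
    have h0 : 0 < a₀ n := hρ₀pos n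
    have h1 : 0 < a₁ n := hρ₁pos n
    rcases ht0.eq_or_lt with h | h
    · rw [← h]; simpa using h0
    · have := mul_pos h h1
      have := mul_nonneg (sub_nonneg.mpr ht1) h0.le
      linarith
  change Lfun σ (matFun Real.log (Smat M b)) ≤ (1 - t) * Lfun σ (matFun Real.log (Smat M a₀)) +
    t * Lfun σ (matFun Real.log (Smat M a₁))
  have key := key_two hN M hM hker σ hσ a₀ a₁ b hρ₀pos hρ₁pos hbpos t ht0 ht1 hbt
  have p0 := Smat_posDef hN M hM hker a₀ hρ₀pos
  have p1 := Smat_posDef hN M hM hker a₁ hρ₁pos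
  have pb := Smat_posDef hN M hM hker b hbpos
  obtain ⟨w0, s0, f0⟩ := Lfun_matFun σ _ p0.isHermitian
  obtain ⟨w1, s1, f1⟩ := Lfun_matFun σ _ p1.isHermitian
  obtain ⟨wb, sb, fb⟩ := Lfun_matFun σ _ pb.isHermitian
  have l0 := p0.eigenvalues_pos
  have l1 := p1.eigenvalues_pos
  have lb := pb.eigenvalues_pos
  simp only [f0, f1, fb] at key ⊢
  rw [hσtr, Complex.one_re] at s0 s1 sb
  generalize p0.isHermitian.eigenvalues = m0 at *
  generalize p1.isHermitian.eigenvalues = m1 at *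
  generalize pb.isHermitian.eigenvalues = mb at *
  set G : ℝ → ℝ := fun T => (1 - t) * (∑ i, w0 i * Real.log (m0 i + T)) +
    t * (∑ i, w1 i * Real.log (m1 i + T)) - ∑ i, wb i * Real.log (mb i + T) with hG
  have hd : ∀ T, 0 ≤ T → HasDerivAt G ((1 - t) * (∑ i, w0 i * (m0 i + T)⁻¹) +
    t * (∑ i, w1 i * (m1 i + T)⁻¹) - ∑ i, wb i * (mb i + T)⁻¹) T := fun T hT =>
    (((sum_log_deriv w0 m0 l0 T hT).const_mul _).add
      ((sum_log_deriv w1 m1 l1 T hT).const_mul _)).sub (sum_log_deriv wb mb lb T hT)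
  have hanti : AntitoneOn G (Set.Ici 0) := by
    refine antitoneOn_of_deriv_nonpos (convex_Ici 0)
      (fun T hT => (hd T hT).continuousAt.continuousWithinAt) ?_ ?_
    · intro T hT
      exact (hd T (interior_subset hT)).differentiableAt.differentiableWithinAt
    · intro T hT
      have hT' : 0 ≤ T := interior_subset hT
      rw [(hd T hT').deriv]
      have := key T hT'
      linarith
  have hlim : Filter.Tendsto G Filter.atTop (nhds 0) := by
    have := (((sum_log_lim w0 m0 s0).const_mul (1 - t)).add
      ((sum_log_lim w1 m1 s1).const_mul t)).sub (sum_log_lim wb mb sb)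
    simp only [mul_zero, add_zero, sub_zero] at this
    refine this.congr fun T => ?_
    simp only [hG]
    ring
  have hG0 : 0 ≤ G 0 := by
    refine le_of_tendsto hlim ?_
    filter_upwards [Filter.eventually_ge_atTop 0] with T hT
    exact hanti (Set.mem_Ici.mpr le_rfl) hT hT
  simp only [hG, add_zero] at hG0
  linarith
end

section
/- Let ρ be a Hermitian positive definite D×D matrix with tr(ρ) = 1 and tr(M_n ρ) > 0 for all n. Then tr( exp( log ρ + log R(ρ) ) ) ≤ tr( ρ · R(ρ) ) = 1, where R(ρ) = (1/N) ∑_{n=1}^N M_n / tr(M_n ρ). -/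
open Matrix
open scoped ComplexOrder

section Helpers

open Filter Topology NormedSpace

lemma gt_pow_sub_pow {𝔸 : Type*} [NormedRing 𝔸] [NormOneClass 𝔸] (x y : 𝔸) (K : ℝ)
    (hK : 1 ≤ K) (hx : ‖x‖ ≤ K) (hy : ‖y‖ ≤ K) (n : ℕ) :
    ‖x ^ n - y ^ n‖ ≤ n * ‖x - y‖ * K ^ n := by
  induction n with
  | zero => simp
  | succ n ih =>
    have e : x ^ (n + 1) - y ^ (n + 1) = x * (x ^ n - y ^ n) + (x - y) * y ^ n := by
      rw [pow_succ', pow_succ']; noncomm_ring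
    have h1 : ‖x * (x ^ n - y ^ n)‖ ≤ K * (n * ‖x - y‖ * K ^ n) :=
      (norm_mul_le _ _).trans (mul_le_mul hx ih (norm_nonneg _) (by linarith))
    have h2 : ‖(x - y) * y ^ n‖ ≤ ‖x - y‖ * K ^ n :=
      (norm_mul_le _ _).trans (mul_le_mul_of_nonneg_left
        ((norm_pow_le y n).trans (pow_le_pow_left₀ (norm_nonneg _) hy n)) (norm_nonneg _))
    have h3 : ‖x - y‖ * K ^ n ≤ ‖x - y‖ * K ^ (n + 1) :=
      mul_le_mul_of_nonneg_left (pow_le_pow_right₀ hK (Nat.le_succ n)) (norm_nonneg _)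
    rw [e]
    refine (norm_add_le _ _).trans ?_
    push_cast
    rw [pow_succ] at h3 ⊢
    nlinarith

lemma gt_bound {𝔸 : Type*} [NormedRing 𝔸] [NormOneClass 𝔸] [NormedAlgebra ℝ 𝔸]
    (f : ℝ → 𝔸) (c : 𝔸) (hf : HasDerivAt f c 0) (hf0 : f 0 = 1) :
    ∃ C : ℝ, 0 ≤ C ∧ ∀ᶠ t in 𝓝 (0 : ℝ), ‖f t‖ ≤ Real.exp (C * |t|) := by
  obtain ⟨C, hC⟩ := hf.differentiableAt.isBigO_sub.bound
  refine ⟨|C|, abs_nonneg _, ?_⟩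
  filter_upwards [hC] with t ht
  rw [hf0, sub_zero, Real.norm_eq_abs] at ht
  have h1 : ‖f t‖ ≤ ‖f t - 1‖ + 1 := by
    have := norm_add_le (f t - 1) 1
    rwa [sub_add_cancel, norm_one] at this
  have h2 := Real.add_one_le_exp (|C| * |t|)
  have h3 : C * |t| ≤ |C| * |t| := mul_le_mul_of_nonneg_right (le_abs_self _) (abs_nonneg _)
  linarith

lemma gt_chernoff {𝔸 : Type*} [NormedRing 𝔸] [NormOneClass 𝔸] [NormedAlgebra ℝ 𝔸]
    (f g : ℝ → 𝔸) (c : 𝔸) (hf : HasDerivAt f c 0) (hf0 : f 0 = 1)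
    (hg : HasDerivAt g c 0) (hg0 : g 0 = 1) (m : ℕ → ℕ) (hm : Tendsto m atTop atTop) :
    Tendsto (fun k => f ((m k : ℝ)⁻¹) ^ m k - g ((m k : ℝ)⁻¹) ^ m k) atTop (𝓝 0) := by
  obtain ⟨C₁, hC₁, h₁⟩ := gt_bound f c hf hf0
  obtain ⟨C₂, hC₂, h₂⟩ := gt_bound g c hg hg0
  have hlim : Tendsto (fun k => ((m k : ℝ)⁻¹)) atTop (𝓝 0) :=
    tendsto_inv_atTop_zero.comp (tendsto_natCast_atTop_atTop.comp hm)
  have hd : HasDerivAt (fun t => f t - g t) 0 0 := by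
    have h := hf.sub hg
    rw [sub_self] at h
    exact h
  have ho := hasDerivAt_iff_isLittleO.1 hd
  simp only [hf0, hg0, sub_self, sub_zero, smul_zero] at ho
  rw [Metric.tendsto_nhds]
  intro ε hε
  have hE := Real.exp_pos (C₁ + C₂)
  have ho' := ho.def (c := ε / (2 * Real.exp (C₁ + C₂))) (by positivity)
  filter_upwards [hlim.eventually h₁, hlim.eventually h₂, hlim.eventually ho',
    hm.eventually_ge_atTop 1] with k a1 a2 a3 hk
  have hmk : (0 : ℝ) < m k := by exact_mod_cast hk
  have habs : |((m k : ℝ)⁻¹)| = (m k : ℝ)⁻¹ := abs_of_pos (inv_pos.2 hmk)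
  rw [habs] at a1 a2
  rw [Real.norm_eq_abs, habs] at a3
  have hi := inv_pos.2 hmk
  have b := gt_pow_sub_pow (f ((m k : ℝ)⁻¹)) (g ((m k : ℝ)⁻¹))
    (Real.exp ((C₁ + C₂) * (m k : ℝ)⁻¹)) (Real.one_le_exp (by positivity))
    (a1.trans (Real.exp_le_exp.2 (by nlinarith [mul_nonneg hC₂ hi.le])))
    (a2.trans (Real.exp_le_exp.2 (by nlinarith [mul_nonneg hC₁ hi.le]))) (m k)
  have e1 : Real.exp ((C₁ + C₂) * (m k : ℝ)⁻¹) ^ m k = Real.exp (C₁ + C₂) := by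
    rw [← Real.exp_nat_mul]; congr 1; field_simp
  rw [e1] at b
  rw [dist_zero_right]
  refine b.trans_lt ?_
  calc (m k : ℝ) * ‖f ((m k : ℝ)⁻¹) - g ((m k : ℝ)⁻¹)‖ * Real.exp (C₁ + C₂)
      ≤ (m k : ℝ) * (ε / (2 * Real.exp (C₁ + C₂)) * (m k : ℝ)⁻¹) * Real.exp (C₁ + C₂) := by
        gcongr
    _ = ε / 2 := by field_simp
    _ < ε := by linarith

lemma gt_trotter {𝔸 : Type*} [NormedRing 𝔸] [NormOneClass 𝔸] [NormedAlgebra ℝ 𝔸]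
    [CompleteSpace 𝔸] (A B : 𝔸) (m : ℕ → ℕ) (hm : Tendsto m atTop atTop) :
    Tendsto (fun k => (exp ((m k : ℝ)⁻¹ • A) * exp ((m k : ℝ)⁻¹ • B)) ^ m k) atTop
      (𝓝 (exp (A + B))) := by
  have hA := hasDerivAt_exp_smul_const (𝕂 := ℝ) A (0 : ℝ)
  have hB := hasDerivAt_exp_smul_const (𝕂 := ℝ) B (0 : ℝ)
  have hAB := hasDerivAt_exp_smul_const (𝕂 := ℝ) (A + B) (0 : ℝ)
  have hmul : HasDerivAt (fun t : ℝ => exp (t • A) * exp (t • B)) (A + B) 0 := by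
    have h := hA.mul hB
    simp only [zero_smul, exp_zero, one_mul, mul_one] at h
    exact h
  have h := gt_chernoff (fun t : ℝ => exp (t • A) * exp (t • B)) (fun t : ℝ => exp (t • (A + B)))
    (A + B) hmul (by simp) (by simpa using hAB) (by simp) m hm
  rw [← tendsto_sub_nhds_zero_iff]
  refine h.congr' ?_
  filter_upwards [hm.eventually_ge_atTop 1] with k hk
  have hmk : (m k : ℝ) ≠ 0 := by
    have : m k ≠ 0 := by omega
    exact_mod_cast this
  congr 1
  let _ : NormedAlgebra ℚ 𝔸 := .restrictScalars ℚ ℝ 𝔸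
  rw [← NormedSpace.exp_nsmul, ← Nat.cast_smul_eq_nsmul ℝ, smul_smul, mul_inv_cancel₀ hmk, one_smul]

variable {D : ℕ}

lemma gt_matrix_trotter (hD : 0 < D) (A B : Matrix (Fin D) (Fin D) ℂ) (m : ℕ → ℕ)
    (hm : Tendsto m atTop atTop) :
    Tendsto (fun k => (exp ((m k : ℝ)⁻¹ • A) * exp ((m k : ℝ)⁻¹ • B)) ^ m k) atTop
      (𝓝 (exp (A + B))) := by
  have : Nonempty (Fin D) := ⟨⟨0, hD⟩⟩
  let _ : NormedRing (Matrix (Fin D) (Fin D) ℂ) := Matrix.linftyOpNormedRing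
  let _ : NormedAlgebra ℝ (Matrix (Fin D) (Fin D) ℂ) := Matrix.linftyOpNormedAlgebra
  have : NormOneClass (Matrix (Fin D) (Fin D) ℂ) := Matrix.linfty_opNormOneClass
  exact gt_trotter A B m hm

lemma gt_trace_pow_comm (X Y : Matrix (Fin D) (Fin D) ℂ) (n : ℕ) :
    ((X * Y) ^ n).trace = ((Y * X) ^ n).trace := by
  cases n with
  | zero => simp
  | succ n =>
    have h : SemiconjBy X ((Y * X) ^ n) ((X * Y) ^ n) :=
      SemiconjBy.pow_right (by simp [SemiconjBy, mul_assoc]) n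
    rw [pow_succ, ← mul_assoc, ← h.eq, Matrix.trace_mul_comm, ← mul_assoc, ← pow_succ']

lemma gt_trace_norm (X : Matrix (Fin D) (Fin D) ℂ) :
    ‖(Xᴴ * X).trace‖ = ∑ i, ∑ j, ‖X j i‖ ^ 2 := by
  have : (Xᴴ * X).trace = ((∑ i, ∑ j, ‖X j i‖ ^ 2 : ℝ) : ℂ) := by
    simp only [Matrix.trace, Matrix.diag, Matrix.mul_apply, Matrix.conjTranspose_apply]
    push_cast
    refine Finset.sum_congr rfl fun i _ => Finset.sum_congr rfl fun j _ => ?_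
    exact Complex.conj_mul' _
  rw [this, Complex.norm_real, Real.norm_of_nonneg (by positivity)]

lemma gt_trace_cs (X Y : Matrix (Fin D) (Fin D) ℂ) :
    2 * ‖(X * Y).trace‖ ≤ ‖(Xᴴ * X).trace‖ + ‖(Yᴴ * Y).trace‖ := by
  rw [gt_trace_norm, gt_trace_norm, Finset.sum_comm, ← Finset.sum_add_distrib]
  have : ‖(X * Y).trace‖ ≤ ∑ i, ∑ j, ‖X i j‖ * ‖Y j i‖ := by
    simp only [Matrix.trace, Matrix.diag, Matrix.mul_apply]
    refine (norm_sum_le _ _).trans (Finset.sum_le_sum fun i _ => (norm_sum_le _ _).trans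
      (Finset.sum_le_sum fun j _ => (norm_mul_le _ _)))
  refine (mul_le_mul_of_nonneg_left this (by norm_num)).trans ?_
  rw [Finset.mul_sum]
  refine Finset.sum_le_sum fun i _ => ?_
  rw [Finset.mul_sum, ← Finset.sum_add_distrib]
  refine Finset.sum_le_sum fun j _ => ?_
  nlinarith [sq_nonneg (‖X i j‖ - ‖Y j i‖)]

lemma gt_joint (k : ℕ) :
    (∀ M : Matrix (Fin D) (Fin D) ℂ, ‖(M ^ (2 * 2 ^ k)).trace‖ ≤ ‖((Mᴴ * M) ^ (2 ^ k)).trace‖) ∧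
    (∀ P Q : Matrix (Fin D) (Fin D) ℂ, P.IsHermitian → Q.IsHermitian →
      ‖((P * Q) ^ (2 ^ k)).trace‖ ≤ ‖(P ^ (2 ^ k) * Q ^ (2 ^ k)).trace‖) := by
  induction k with
  | zero =>
    refine ⟨fun M => ?_, fun P Q _ _ => by simp⟩
    have := gt_trace_cs M M
    simp only [pow_zero, mul_one, pow_one, pow_two]
    linarith
  | succ k ih =>
    obtain ⟨H, G⟩ := ih
    set m := 2 ^ k with hm
    have h2 : 2 ^ (k + 1) = 2 * m := by rw [pow_succ]; ring
    rw [h2]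
    refine ⟨fun M => ?_, fun P Q hP hQ => ?_⟩
    · have hP : (Mᴴ * M).IsHermitian := Matrix.isHermitian_conjTranspose_mul_self M
      have hQ : (M * Mᴴ).IsHermitian := Matrix.isHermitian_mul_conjTranspose_self M
      have s1 := H (M ^ 2)
      rw [← pow_mul] at s1
      have s2 : (((M ^ 2)ᴴ * M ^ 2) ^ m).trace = (((Mᴴ * M) * (M * Mᴴ)) ^ m).trace := by
        have := gt_trace_pow_comm Mᴴ (Mᴴ * M * M) m
        rw [pow_two, Matrix.conjTranspose_mul]
        simpa only [mul_assoc] using this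
      have s3 := G _ _ hP hQ
      have s4 := gt_trace_cs ((Mᴴ * M) ^ m) ((M * Mᴴ) ^ m)
      rw [(hP.pow m).eq, (hQ.pow m).eq, ← pow_add, ← pow_add, ← two_mul,
        gt_trace_pow_comm M Mᴴ] at s4
      rw [s2] at s1
      linarith
    · have s1 := H (P * Q)
      have s2 : (((P * Q)ᴴ * (P * Q)) ^ m).trace = ((P ^ 2 * Q ^ 2) ^ m).trace := by
        have := gt_trace_pow_comm Q (P * P * Q) m
        rw [Matrix.conjTranspose_mul, hP.eq, hQ.eq, pow_two, pow_two]
        simpa only [mul_assoc] using this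
      have s3 := G _ _ (hP.pow 2) (hQ.pow 2)
      rw [← pow_mul, ← pow_mul] at s3
      rw [s2] at s1
      exact s1.trans s3

lemma gt_golden_thompson (hD : 0 < D) (A B : Matrix (Fin D) (Fin D) ℂ)
    (hA : A.IsHermitian) (hB : B.IsHermitian) :
    ‖(exp (A + B)).trace‖ ≤ ‖(exp A * exp B).trace‖ := by
  have hm : Tendsto (fun k : ℕ => 2 ^ k) atTop atTop :=
    tendsto_pow_atTop_atTop_of_one_lt (by norm_num : 1 < 2)
  have h := gt_matrix_trotter hD A B _ hm
  have hc : Continuous (fun X : Matrix (Fin D) (Fin D) ℂ => ‖X.trace‖) :=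
    (continuous_id.matrix_trace).norm
  refine le_of_tendsto ((hc.tendsto _).comp h) (Eventually.of_forall fun k => ?_)
  have key : ∀ X : Matrix (Fin D) (Fin D) ℂ,
      exp (((2 ^ k : ℕ) : ℝ)⁻¹ • X) ^ (2 ^ k) = exp X := fun X => by
    rw [← Matrix.exp_nsmul, ← Nat.cast_smul_eq_nsmul ℝ, smul_smul,
      mul_inv_cancel₀ (by positivity), one_smul]
  have herm : ∀ X : Matrix (Fin D) (Fin D) ℂ, X.IsHermitian →
      (exp (((2 ^ k : ℕ) : ℝ)⁻¹ • X)).IsHermitian := fun X hX => by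
    apply Matrix.IsHermitian.exp
    rw [Matrix.IsHermitian, Matrix.conjTranspose_smul, hX.eq, star_trivial]
  have := (gt_joint k).2 _ _ (herm A hA) (herm B hB)
  rwa [key, key] at this

lemma gt_matFun_herm (g : ℝ → ℝ) (A : Matrix (Fin D) (Fin D) ℂ) : (matFun g A).IsHermitian := by
  unfold matFun
  split_ifs with hA
  · rw [Matrix.IsHermitian, Matrix.conjTranspose_mul, Matrix.conjTranspose_mul,
      Matrix.star_eq_conjTranspose, Matrix.conjTranspose_conjTranspose,
      Matrix.diagonal_conjTranspose, mul_assoc]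
    congr 3
    ext i
    simp
  · exact Matrix.isHermitian_zero

lemma gt_matFun_id (A : Matrix (Fin D) (Fin D) ℂ) (hA : A.IsHermitian) : matFun id A = A := by
  conv_rhs => rw [hA.spectral_theorem]
  rw [matFun, dif_pos hA, Unitary.conjStarAlgAut_apply]
  rfl

lemma gt_exp_matFun (g : ℝ → ℝ) (A : Matrix (Fin D) (Fin D) ℂ) (hA : A.IsHermitian) :
    exp (matFun g A) = matFun (fun x => Real.exp (g x)) A := by
  rw [matFun, matFun, dif_pos hA, dif_pos hA]
  have hu := Matrix.exp_units_conj (Unitary.toUnits hA.eigenvectorUnitary)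
    (Matrix.diagonal (fun i => (g (hA.eigenvalues i) : ℂ)))
  have e : ((Unitary.toUnits hA.eigenvectorUnitary)⁻¹ : (Matrix (Fin D) (Fin D) ℂ)ˣ).val
    = star (hA.eigenvectorUnitary : Matrix (Fin D) (Fin D) ℂ) := rfl
  rw [e, Matrix.exp_diagonal] at hu
  refine hu.trans ?_
  congr 3
  ext i
  rw [Pi.coe_exp, ← Complex.exp_eq_exp_ℂ, Complex.ofReal_exp]

lemma gt_mexp (A : Matrix (Fin D) (Fin D) ℂ) (hA : A.IsHermitian) : mexp A = exp A := by
  conv_rhs => rw [← gt_matFun_id A hA]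
  rw [gt_exp_matFun _ _ hA]
  rfl

lemma gt_exp_mlog (A : Matrix (Fin D) (Fin D) ℂ) (hA : A.PosDef) : exp (mlog A) = A := by
  rw [mlog, gt_exp_matFun _ _ hA.isHermitian]
  conv_rhs => rw [← gt_matFun_id A hA.isHermitian]
  rw [matFun, matFun, dif_pos hA.isHermitian, dif_pos hA.isHermitian]
  congr 3
  ext i
  rw [Real.exp_log (hA.eigenvalues_pos i)]
  rfl

lemma gt_Rmat_posDef {N : ℕ} (hN : 0 < N)
    (M : Fin N → Matrix (Fin D) (Fin D) ℂ)
    (hM : ∀ n, (M n).PosSemidef)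
    (hker : ∀ v : Fin D → ℂ, (∀ n, (M n) *ᵥ v = 0) → v = 0)
    (ρ : Matrix (Fin D) (Fin D) ℂ) (hρpos : ∀ n, 0 < (M n * ρ).trace.re) :
    (Rmat M ρ).PosDef := by
  have hN' : (0 : ℝ) < (N : ℝ)⁻¹ := inv_pos.2 (by exact_mod_cast hN)
  have hps : ∀ n, (((M n * ρ).trace.re)⁻¹ • M n).PosSemidef := fun n =>
    (hM n).smul (inv_pos.2 (hρpos n)).le
  refine Matrix.PosDef.smul ?_ hN'
  have hS := Matrix.posSemidef_sum Finset.univ (fun n _ => hps n)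
  refine Matrix.PosDef.of_dotProduct_mulVec_pos hS.isHermitian fun x hx => ?_
  refine lt_of_le_of_ne (hS.dotProduct_mulVec_nonneg x) fun h0 => hx (hker x fun n => ?_)
  rw [Matrix.sum_mulVec, dotProduct_sum] at h0
  have h1 := (Finset.sum_eq_zero_iff_of_nonneg
    (fun n _ => (hps n).dotProduct_mulVec_nonneg x)).1 h0.symm n (Finset.mem_univ n)
  rw [(hps n).dotProduct_mulVec_zero_iff, Matrix.smul_mulVec] at h1
  exact (smul_eq_zero.1 h1).resolve_left (inv_pos.2 (hρpos n)).ne'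

lemma gt_trace_one {N : ℕ} (hN : 0 < N)
    (M : Fin N → Matrix (Fin D) (Fin D) ℂ)
    (hM : ∀ n, (M n).PosSemidef)
    (ρ : Matrix (Fin D) (Fin D) ℂ) (hρ : ρ.PosDef) (hρpos : ∀ n, 0 < (M n * ρ).trace.re) :
    (ρ * Rmat M ρ).trace = 1 := by
  have hre : ∀ n, (ρ * M n).trace = ((M n * ρ).trace.re : ℂ) := fun n => by
    have h : star (M n * ρ).trace = (M n * ρ).trace := by
      rw [← Matrix.trace_conjTranspose, Matrix.conjTranspose_mul, hρ.isHermitian.eq,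
        (hM n).isHermitian.eq, Matrix.trace_mul_comm]
    rw [Matrix.trace_mul_comm]
    exact (Complex.conj_eq_iff_re.1 h).symm
  have hN' : (N : ℂ) ≠ 0 := by exact_mod_cast hN.ne'
  rw [Rmat, Matrix.mul_smul, Matrix.trace_smul, Matrix.mul_sum, Matrix.trace_sum]
  have : ∀ n, (ρ * (((M n * ρ).trace.re)⁻¹ • M n)).trace = 1 := fun n => by
    have h0 : ((M n * ρ).trace.re : ℂ) ≠ 0 := by exact_mod_cast (hρpos n).ne'
    rw [Matrix.mul_smul, Matrix.trace_smul, hre, Complex.real_smul, Complex.ofReal_inv,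
      inv_mul_cancel₀ h0]
  rw [Finset.sum_congr rfl fun n _ => this n]
  simp [hN']

end Helpers

/-- Golden–Thompson step: `tr(exp(log ρ + log R(ρ))) ≤ tr(ρ R(ρ)) = 1`. -/
theorem stmt7 {D N : ℕ} (hD : 0 < D) (hN : 0 < N)
    (M : Fin N → Matrix (Fin D) (Fin D) ℂ)
    (hM : ∀ n, (M n).PosSemidef) (hMne : ∀ n, M n ≠ 0)
    (hker : ∀ v : Fin D → ℂ, (∀ n, (M n) *ᵥ v = 0) → v = 0)
    (ρ : Matrix (Fin D) (Fin D) ℂ)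
    (hρ : ρ.PosDef) (hρtr : ρ.trace = 1) (hρpos : ∀ n, 0 < (M n * ρ).trace.re) :
    (mexp (mlog ρ + mlog (Rmat M ρ))).trace.re ≤ ((ρ * Rmat M ρ).trace).re ∧
    (ρ * Rmat M ρ).trace = 1 := by
  have h1 := gt_trace_one hN M hM ρ hρ hρpos
  refine ⟨?_, h1⟩
  have hR := gt_Rmat_posDef hN M hM hker ρ hρpos
  have hl1 : (mlog ρ).IsHermitian := gt_matFun_herm _ _
  have hl2 : (mlog (Rmat M ρ)).IsHermitian := gt_matFun_herm _ _
  have h := gt_golden_thompson hD _ _ hl1 hl2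
  rw [gt_exp_mlog _ hρ, gt_exp_mlog _ hR, h1, norm_one] at h
  rw [h1, Complex.one_re, gt_mexp _ (hl1.add hl2)]
  exact (Complex.re_le_norm _).trans h
end

section
/- Let (ρ_k) be the iterates of the algorithm ρ₁ = I/D and ρ_{k+1} = exp(log ρ_k + log R(ρ_k)) / tr(exp(log ρ_k + log R(ρ_k))), and let ρ̄_K = (ρ₁ + ⋯ + ρ_K)/K. Then for every K ∈ ℕ and every density matrix σ, (1/K) ∑_{k=1}^K tr(σ · log R(ρ_k)) ≤ (1/K) tr( σ · (log ρ_{K+1} − log ρ₁) ) ≤ (log D)/K, and consequently max_{σ ∈ 𝒟} tr(σ · log R(ρ̄_K)) ≤ (log D)/K. -/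
open Matrix
open scoped ComplexOrder

section helpers

open scoped MatrixOrder Matrix.Norms.L2Operator

lemma trpow_comm {D : ℕ} (A B : Matrix (Fin D) (Fin D) ℂ) (m : ℕ) :
    ((A * B) ^ m).trace = ((B * A) ^ m).trace := by
  cases m with
  | zero => simp
  | succ m =>
    have h : ∀ m : ℕ, (A * B) ^ m * A = A * (B * A) ^ m := by
      intro m
      induction m with
      | zero => simp
      | succ m ih => rw [pow_succ, pow_succ', ← mul_assoc A, mul_assoc _ (A * B) A,
          mul_assoc A B A, ← mul_assoc _ A, ih, mul_assoc, ← pow_succ, mul_assoc, ← pow_succ']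

    rw [pow_succ, ← mul_assoc, h, Matrix.trace_mul_comm, ← mul_assoc, ← pow_succ']

lemma tr_mul_le {D : ℕ} (X Y : Matrix (Fin D) (Fin D) ℂ) :
    (X * Y).trace.re ≤ ((X * Xᴴ).trace.re + (Y * Yᴴ).trace.re) / 2 := by
  have h := (Matrix.posSemidef_self_mul_conjTranspose (X - Yᴴ)).trace_nonneg
  have h2 := (Complex.le_def.1 h).1
  have h3 : (Yᴴ * Xᴴ).trace.re = (X * Y).trace.re := by
    rw [← Matrix.conjTranspose_mul, Matrix.trace_conjTranspose]; simp
  have h4 : (Yᴴ * Y).trace = (Y * Yᴴ).trace := Matrix.trace_mul_comm _ _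
  simp only [Matrix.conjTranspose_sub, Matrix.conjTranspose_conjTranspose, sub_mul, mul_sub,
    Matrix.trace_sub, Complex.sub_re, Complex.zero_re, h3, h4] at h2
  linarith

lemma gt_pow {D : ℕ} (j : ℕ) :
    (∀ X : Matrix (Fin D) (Fin D) ℂ,
      (X ^ (2 ^ (j+1))).trace.re ≤ ((X * Xᴴ) ^ (2 ^ j)).trace.re) ∧
    (∀ P Q : Matrix (Fin D) (Fin D) ℂ, P.IsHermitian → Q.IsHermitian →
      ((P * Q) ^ (2 ^ j)).trace.re ≤ (P ^ (2 ^ j) * Q ^ (2 ^ j)).trace.re) := by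
  induction j with
  | zero =>
    refine ⟨fun X => ?_, fun P Q _ _ => by simp⟩
    have := tr_mul_le X X
    simp only [zero_add, pow_one, pow_zero, pow_two]
    linarith
  | succ j ih =>
    obtain ⟨ih1, ih2⟩ := ih
    constructor
    · intro X
      have e1 : X ^ (2 ^ (j+1+1)) = (X * X) ^ (2 ^ (j+1)) := by
        rw [← pow_two, ← pow_mul, ← pow_succ']
      have e2 : ((X * X * (X * X)ᴴ) ^ (2 ^ j)).trace
          = (((Xᴴ * X) * (X * Xᴴ)) ^ (2 ^ j)).trace := by
        rw [Matrix.conjTranspose_mul, show X * X * (Xᴴ * Xᴴ) = (X * X * Xᴴ) * Xᴴ by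
          simp only [mul_assoc], trpow_comm]
        simp only [mul_assoc]
      have hH1 : (Xᴴ * X).IsHermitian := Matrix.isHermitian_conjTranspose_mul_self X
      have hH2 : (X * Xᴴ).IsHermitian := Matrix.isHermitian_mul_conjTranspose_self X
      have s1 := ih1 (X * X)
      have s2 := ih2 _ _ hH1 hH2
      have s3 := tr_mul_le ((Xᴴ * X) ^ (2 ^ j)) ((X * Xᴴ) ^ (2 ^ j))
      rw [(hH1.pow _).eq, (hH2.pow _).eq, ← pow_add, ← pow_add, ← two_mul, ← pow_succ',
        trpow_comm Xᴴ X] at s3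
      rw [e1]
      rw [e2] at s1
      linarith
    · intro P Q hP hQ
      have s1 := ih1 (P * Q)
      have e1 : ((P * Q * (P * Q)ᴴ) ^ (2 ^ j)).trace = (((P * P) * (Q * Q)) ^ (2 ^ j)).trace := by
        rw [Matrix.conjTranspose_mul, hP.eq, hQ.eq, ← mul_assoc, trpow_comm]
        simp only [mul_assoc]
      have hPP : (P * P).IsHermitian := by rw [← pow_two]; exact hP.pow 2
      have hQQ : (Q * Q).IsHermitian := by rw [← pow_two]; exact hQ.pow 2
      have s2 := ih2 _ _ hPP hQQ
      rw [← pow_two, ← pow_two, ← pow_mul, ← pow_mul, ← pow_succ'] at s2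
      rw [e1, ← pow_two, ← pow_two] at s1
      linarith

lemma norm_pow_sub_pow_le' {A : Type*} [NormedRing A] [NormOneClass A] (a b : A) (c : ℝ)
    (ha : ‖a‖ ≤ c) (hb : ‖b‖ ≤ c) (n : ℕ) : ‖a ^ n - b ^ n‖ ≤ n * c ^ (n - 1) * ‖a - b‖ := by
  have hc : 0 ≤ c := (norm_nonneg _).trans ha
  induction n with
  | zero => simp
  | succ n ih =>
    have e : a ^ (n+1) - b ^ (n+1) = a ^ n * (a - b) + (a ^ n - b ^ n) * b := by
      rw [pow_succ, pow_succ]; noncomm_ring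
    rw [e]
    have h1 : ‖a ^ n * (a - b)‖ ≤ c ^ n * ‖a - b‖ :=
      (norm_mul_le _ _).trans (by gcongr; exact (norm_pow_le _ _).trans (by gcongr))
    have h2 : ‖(a ^ n - b ^ n) * b‖ ≤ n * c ^ n * ‖a - b‖ := by
      refine (norm_mul_le _ _).trans ((mul_le_mul ih hb (norm_nonneg _) (by positivity)).trans ?_)
      cases n with
      | zero => simp
      | succ n => simp only [Nat.add_sub_cancel]; rw [pow_succ]; apply le_of_eq; ring
    refine (norm_add_le _ _).trans ((add_le_add h1 h2).trans ?_)
    simp only [Nat.add_sub_cancel]; push_cast; apply le_of_eq; ring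

open NormedSpace Filter Topology in
lemma lie_trotter {A : Type*} [NormedRing A] [NormOneClass A] [NormedAlgebra ℝ A]
    [CompleteSpace A] (H L : A) :
    Tendsto (fun n : ℕ => (exp ((n : ℝ)⁻¹ • H) * exp ((n : ℝ)⁻¹ • L)) ^ n) atTop
      (𝓝 (exp (H + L))) := by
  have dH (X : A) : HasDerivAt (fun t : ℝ => exp (t • X)) X 0 := by
    simpa using hasDerivAt_exp_smul_const (𝕂 := ℝ) X (0 : ℝ)
  have dF : HasDerivAt (fun t : ℝ => exp (t • H) * exp (t • L)) (H + L) 0 := by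
    have := (dH H).mul (dH L)
    simp only [zero_smul, exp_zero, one_mul, mul_one] at this
    exact this
  have dG := dF.sub (dH (H + L))
  rw [sub_self] at dG
  set F : ℝ → A := fun t : ℝ => exp (t • H) * exp (t • L) with hF
  set G : ℝ → A := fun t : ℝ => exp (t • (H + L)) with hG
  set c : ℝ := ‖H + L‖ + 1 with hc
  have hinv : Tendsto (fun n : ℕ => (n : ℝ)⁻¹) atTop (𝓝 0) := tendsto_inv_atTop_nhds_zero_nat
  have bd (f : ℝ → A) (hf : HasDerivAt f (H + L) 0) (h1 : f 0 = 1) :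
      ∀ᶠ n : ℕ in atTop, ‖f (n : ℝ)⁻¹‖ ≤ Real.exp (c * (n : ℝ)⁻¹) := by
    have := hf.hasFDerivAt.isLittleO
    have h2 := hinv.eventually (this.def (c := 1) one_pos)
    filter_upwards [h2] with n hn
    simp only [h1, sub_zero, one_mul] at hn
    simp at hn
    have hp : (0 : ℝ) ≤ (n : ℝ)⁻¹ := by positivity
    calc ‖f (n : ℝ)⁻¹‖ = ‖(f (n : ℝ)⁻¹ - 1 - (n : ℝ)⁻¹ • (H + L)) + 1 + (n : ℝ)⁻¹ • (H + L)‖ := by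
          congr 1; abel
      _ ≤ ‖(f (n : ℝ)⁻¹ - 1 - (n : ℝ)⁻¹ • (H + L))‖ + ‖(1 : A)‖ + ‖(n : ℝ)⁻¹ • (H + L)‖ :=
          norm_add₃_le
      _ ≤ (n : ℝ)⁻¹ + 1 + (n : ℝ)⁻¹ * ‖H + L‖ := by
          rw [norm_smul, Real.norm_of_nonneg hp, norm_one]
          gcongr
          simpa using hn
      _ = c * (n : ℝ)⁻¹ + 1 := by rw [hc]; ring
      _ ≤ _ := Real.add_one_le_exp _
  have b1 := bd F dF (by simp [hF])
  have b2 := bd G (dH (H + L)) (by simp [hG])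
  have key : Tendsto (fun n : ℕ => F (n : ℝ)⁻¹ ^ n - G (n : ℝ)⁻¹ ^ n) atTop (𝓝 0) := by
    have hz : (F - G) 0 = 0 := by simp [hF, hG]
    rw [Metric.tendsto_nhds]
    intro ε hε
    have hlo := dG.hasFDerivAt.isLittleO
    have hε' : 0 < ε / 2 * Real.exp (-c) := by positivity
    have h3 := hinv.eventually (hlo.def hε')
    filter_upwards [b1, b2, h3, eventually_gt_atTop 0] with n h1 h2 h3 hn
    have hn' : (0 : ℝ) < n := by exact_mod_cast hn
    have hp : (0 : ℝ) ≤ (n : ℝ)⁻¹ := by positivity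
    rw [hz] at h3
    simp only [sub_zero, Pi.sub_apply, Real.norm_of_nonneg hp,
      ContinuousLinearMap.toSpanSingleton_apply, smul_zero] at h3
    rw [dist_zero_right]
    have hexp : Real.exp (c * (n : ℝ)⁻¹) ^ (n - 1) ≤ Real.exp c := by
      have hc0 : 0 ≤ c := by positivity
      calc Real.exp (c * (n : ℝ)⁻¹) ^ (n - 1) ≤ Real.exp (c * (n : ℝ)⁻¹) ^ n :=
            pow_le_pow_right₀ (Real.one_le_exp (by positivity)) (by omega)
        _ = Real.exp c := by
            rw [← Real.exp_nat_mul]; congr 1; field_simp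
    calc _ ≤ n * Real.exp (c * (n : ℝ)⁻¹) ^ (n - 1) * ‖F (n : ℝ)⁻¹ - G (n : ℝ)⁻¹‖ :=
          norm_pow_sub_pow_le' _ _ _ h1 h2 n
      _ ≤ n * Real.exp c * (ε / 2 * Real.exp (-c) * (n : ℝ)⁻¹) := by gcongr
      _ = ε / 2 * (n * (n : ℝ)⁻¹) * (Real.exp c * Real.exp (-c)) := by ring
      _ = ε / 2 := by rw [← Real.exp_add, mul_inv_cancel₀ hn'.ne']; simp
      _ < ε := by linarith
  have hGn : ∀ᶠ n : ℕ in atTop, G (n : ℝ)⁻¹ ^ n = exp (H + L) := by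
    filter_upwards [eventually_gt_atTop 0] with n hn
    have hne : (n : ℝ) ≠ 0 := by positivity
    simp only [hG]
    let +nondep : NormedAlgebra ℚ A := .restrictScalars ℚ ℝ A
    rw [← NormedSpace.exp_nsmul, ← Nat.cast_smul_eq_nsmul ℝ, smul_smul, mul_inv_cancel₀ hne, one_smul]
  have := key.add (tendsto_const_nhds (x := exp (H + L)))
  rw [zero_add] at this
  refine this.congr' ?_
  filter_upwards [hGn] with n hn
  rw [hn]; simp [hF]

open NormedSpace Filter Topology in
lemma golden_thompson {D : ℕ} (hD : 0 < D) (H L : Matrix (Fin D) (Fin D) ℂ)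
    (hH : H.IsHermitian) (hL : L.IsHermitian) :
    (exp (H + L)).trace.re ≤ (exp H * exp L).trace.re := by
  have : Nonempty (Fin D) := ⟨⟨0, hD⟩⟩
  have ht := lie_trotter H L
  have h2 : Tendsto (fun j : ℕ => 2 ^ j) atTop atTop := tendsto_pow_atTop_atTop_of_one_lt one_lt_two
  have ht2 := ht.comp h2
  have hcont : Continuous (fun X : Matrix (Fin D) (Fin D) ℂ => X.trace.re) :=
    Complex.continuous_re.comp (continuous_id.matrix_trace)
  have ht3 := (hcont.tendsto _).comp ht2
  refine le_of_tendsto ht3 (Eventually.of_forall fun j => ?_)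
  simp only [Function.comp]
  have hs (X : Matrix (Fin D) (Fin D) ℂ) :
      exp ((((2 ^ j : ℕ) : ℝ))⁻¹ • X) ^ (2 ^ j) = exp X := by
    have hne : ((2 ^ j : ℕ) : ℝ) ≠ 0 := by positivity
    rw [← Matrix.exp_nsmul, ← Nat.cast_smul_eq_nsmul ℝ, smul_smul, mul_inv_cancel₀ hne, one_smul]
  have hh (X : Matrix (Fin D) (Fin D) ℂ) (hX : X.IsHermitian) :
      (exp ((((2 ^ j : ℕ) : ℝ))⁻¹ • X)).IsHermitian := by
    apply Matrix.IsHermitian.exp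
    rw [Matrix.IsHermitian, Matrix.conjTranspose_smul, hX.eq]; simp
  have := (gt_pow j).2 _ _ (hh H hH) (hh L hL)
  rw [hs, hs] at this
  exact this

lemma matFun_eq {D : ℕ} (g : ℝ → ℝ) (A : Matrix (Fin D) (Fin D) ℂ) : matFun g A = cfc g A := by
  unfold matFun
  split_ifs with hA
  · rw [hA.cfc_eq, Matrix.IsHermitian.cfc, Unitary.conjStarAlgAut_apply]
    rfl
  · rw [cfc_apply_of_not_predicate]; exact hA

lemma mlog_eq {D : ℕ} (A : Matrix (Fin D) (Fin D) ℂ) : mlog A = CFC.log A := matFun_eq _ _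

lemma mexp_eq {D : ℕ} (A : Matrix (Fin D) (Fin D) ℂ) (hA : A.IsHermitian) :
    mexp A = NormedSpace.exp A := by
  unfold mexp
  rw [matFun_eq, CFC.real_exp_eq_normedSpace_exp hA]

lemma exp_posDef {D : ℕ} (A : Matrix (Fin D) (Fin D) ℂ) (hA : A.IsHermitian) :
    (NormedSpace.exp A).PosDef := by
  have h : (NormedSpace.exp A).PosSemidef :=
    (IsSelfAdjoint.exp_nonneg (a := A) hA).posSemidef
  rw [h.posDef_iff_isUnit]
  exact Matrix.isUnit_exp A

lemma log_herm {D : ℕ} (A : Matrix (Fin D) (Fin D) ℂ) : (CFC.log A).IsHermitian :=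
  IsSelfAdjoint.log (a := A)

lemma log_inv' {D : ℕ} (A : Matrix (Fin D) (Fin D) ℂ) (hA : A.PosDef) :
    CFC.log A⁻¹ = - CFC.log A := by
  conv_lhs => rw [← CFC.exp_log A hA.isStrictlyPositive]
  rw [← Matrix.exp_neg, CFC.log_exp _ (IsSelfAdjoint.log (a := A)).neg]

lemma tr_mul_nonneg {D : ℕ} {S X : Matrix (Fin D) (Fin D) ℂ} (hS : S.PosSemidef)
    (hX : X.PosSemidef) : 0 ≤ (S * X).trace := by
  obtain ⟨C, rfl⟩ := CStarAlgebra.nonneg_iff_eq_star_mul_self.mp hS.nonneg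
  rw [mul_assoc, Matrix.trace_mul_comm, Matrix.star_eq_conjTranspose]
  exact (hX.mul_mul_conjTranspose_same C).trace_nonneg

lemma tr_mono {D : ℕ} {S X Y : Matrix (Fin D) (Fin D) ℂ} (hS : S.PosSemidef)
    (hXY : X ≤ Y) : (S * X).trace.re ≤ (S * Y).trace.re := by
  have := (Complex.le_def.1 (tr_mul_nonneg hS (Matrix.le_iff.1 hXY))).1
  rw [mul_sub, Matrix.trace_sub] at this
  simpa using this

lemma tr_mul_pos {D : ℕ} {S X : Matrix (Fin D) (Fin D) ℂ} (hS : S.PosSemidef) (hS0 : S ≠ 0)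
    (hX : X.PosDef) : 0 < (S * X).trace.re := by
  have h0 := tr_mul_nonneg hS hX.posSemidef
  have h1 := (Complex.le_def.1 h0)
  refine lt_of_le_of_ne h1.1 fun h => hS0 ?_
  have hz : (S * X).trace = 0 := Complex.ext h.symm (by simpa using h1.2.symm)
  obtain ⟨B, rfl⟩ := CStarAlgebra.nonneg_iff_eq_star_mul_self.mp hS.nonneg
  have hu := hX.isUnit
  obtain ⟨C, rfl⟩ := CStarAlgebra.nonneg_iff_eq_star_mul_self.mp hX.posSemidef.nonneg
  have hCu : IsUnit C := by
    rw [Matrix.isUnit_iff_isUnit_det] at hu ⊢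
    rw [Matrix.det_mul] at hu
    exact isUnit_of_mul_isUnit_right hu
  have e : (star B * B * (star C * C)).trace = (Matrix.conjTranspose (C * star B) * (C * star B)).trace := by
    simp only [Matrix.conjTranspose_mul, Matrix.star_eq_conjTranspose,
      Matrix.conjTranspose_conjTranspose]
    rw [mul_assoc, Matrix.trace_mul_comm]
    simp only [mul_assoc]
  rw [e, Matrix.trace_conjTranspose_mul_self_eq_zero_iff] at hz
  have : star B = 0 := by
    have h3 := hCu.mul_right_injective (a₁ := star B) (a₂ := 0)
    exact h3 (by simpa using hz)
  rw [this, zero_mul]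

lemma comb_posDef {D N : ℕ} (M : Fin N → Matrix (Fin D) (Fin D) ℂ)
    (hM : ∀ n, (M n).PosSemidef)
    (hker : ∀ v : Fin D → ℂ, (∀ n, (M n) *ᵥ v = 0) → v = 0) (a : Fin N → ℝ) (ha : ∀ n, 0 < a n) :
    (∑ n, a n • M n).PosDef := by
  have hps : ∀ n, (a n • M n).PosSemidef := fun n => (hM n).smul (ha n).le
  have hs : (∑ n, a n • M n).PosSemidef := Matrix.posSemidef_sum _ fun n _ => hps n
  refine Matrix.PosDef.of_dotProduct_mulVec_pos hs.1 fun v hv => ?_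
  refine lt_of_le_of_ne (hs.dotProduct_mulVec_nonneg v) fun h => hv (hker v fun n => ?_)
  rw [Matrix.sum_mulVec, dotProduct_sum] at h
  have := (Finset.sum_eq_zero_iff_of_nonneg
    (fun n _ => (hps n).dotProduct_mulVec_nonneg v)).1 h.symm n (Finset.mem_univ _)
  rw [(hps n).dotProduct_mulVec_zero_iff, Matrix.smul_mulVec] at this
  exact (smul_eq_zero.1 this).resolve_left (ha n).ne'

lemma Rmat_posDef {D N : ℕ} (hN : 0 < N) (M : Fin N → Matrix (Fin D) (Fin D) ℂ)
    (hM : ∀ n, (M n).PosSemidef) (hMne : ∀ n, M n ≠ 0)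
    (hker : ∀ v : Fin D → ℂ, (∀ n, (M n) *ᵥ v = 0) → v = 0)
    (X : Matrix (Fin D) (Fin D) ℂ) (hX : X.PosDef) : (Rmat M X).PosDef := by
  unfold Rmat
  refine Matrix.PosDef.smul (comb_posDef M hM hker _ fun n => ?_) (by positivity)
  exact inv_pos.2 (tr_mul_pos (hM n) (hMne n) hX)

lemma tr_Rmat {D N : ℕ} (hN : 0 < N) (M : Fin N → Matrix (Fin D) (Fin D) ℂ)
    (hM : ∀ n, (M n).PosSemidef) (hMne : ∀ n, M n ≠ 0)
    (X : Matrix (Fin D) (Fin D) ℂ) (hX : X.PosDef) : (X * Rmat M X).trace.re = 1 := by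
  unfold Rmat
  rw [Matrix.mul_smul, Matrix.trace_smul, Matrix.mul_sum, Matrix.trace_sum, Complex.smul_re,
    Complex.re_sum]
  have : ∀ n, (X * ((M n * X).trace.re⁻¹ • M n)).trace.re = 1 := by
    intro n
    rw [Matrix.mul_smul, Matrix.trace_smul, Complex.smul_re, Matrix.trace_mul_comm X, smul_eq_mul]
    exact inv_mul_cancel₀ (tr_mul_pos (hM n) (hMne n) hX).ne'
  rw [Finset.sum_congr rfl fun n _ => this n]
  simp [hN.ne']

/-- one algorithm step -/
lemma step_facts {D N : ℕ} (hD : 0 < D) (hN : 0 < N) (M : Fin N → Matrix (Fin D) (Fin D) ℂ)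
    (hM : ∀ n, (M n).PosSemidef) (hMne : ∀ n, M n ≠ 0)
    (hker : ∀ v : Fin D → ℂ, (∀ n, (M n) *ᵥ v = 0) → v = 0)
    (X Y : Matrix (Fin D) (Fin D) ℂ) (hX : X.PosDef)
    (hY : Y = ((mexp (mlog X + mlog (Rmat M X))).trace)⁻¹ • mexp (mlog X + mlog (Rmat M X))) :
    Y.PosDef ∧ Y.trace = 1 ∧ mlog X + mlog (Rmat M X) ≤ mlog Y := by
  have : Nonempty (Fin D) := ⟨⟨0, hD⟩⟩
  have hR := Rmat_posDef hN M hM hMne hker X hX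
  simp only [mlog_eq] at hY ⊢
  have hH := (log_herm X).add (log_herm (Rmat M X))
  rw [mexp_eq _ hH] at hY
  have hE := exp_posDef _ hH
  have hGT := golden_thompson hD _ _ (log_herm X) (log_herm (Rmat M X))
  rw [CFC.exp_log X hX.isStrictlyPositive, CFC.exp_log _ hR.isStrictlyPositive,
    tr_Rmat hN M hM hMne X hX] at hGT
  set H := CFC.log X + CFC.log (Rmat M X) with hHdef
  set E := NormedSpace.exp H with hEdef
  have htr := hE.trace_pos
  set z : ℝ := E.trace.re with hz
  have hzE : E.trace = (z : ℂ) := Complex.ext rfl (by simpa using (Complex.lt_def.1 htr).2.symm)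
  have hz0 : 0 < z := by simpa using (Complex.lt_def.1 htr).1
  have hY2 : Y = z⁻¹ • E := by
    rw [hY, hzE, ← Complex.ofReal_inv]; rfl
  have hYp : Y.PosDef := by rw [hY2]; exact hE.smul (inv_pos.2 hz0)
  refine ⟨hYp, ?_, ?_⟩
  · rw [hY, Matrix.trace_smul, smul_eq_mul, inv_mul_cancel₀ htr.ne']
  · rw [hY2, CFC.log_smul' E (inv_pos.2 hz0) hE.isStrictlyPositive, hEdef, CFC.log_exp H hH]
    refine le_add_of_nonneg_left ?_
    rw [Algebra.algebraMap_eq_smul_one]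
    have : 0 ≤ Real.log z⁻¹ := Real.log_nonneg ((one_le_inv₀ hz0).2 hGT)
    exact (Matrix.PosSemidef.one.smul this).nonneg

lemma log_nonpos' {D : ℕ} (X : Matrix (Fin D) (Fin D) ℂ) (hX : X.PosDef) (h1 : X.trace = 1) :
    mlog X ≤ 0 := by
  rw [mlog_eq, CFC.log]
  refine cfc_nonpos _ _ fun x hx => ?_
  rw [hX.1.spectrum_real_eq_range_eigenvalues] at hx
  obtain ⟨i, rfl⟩ := hx
  have hsum : ∑ i, hX.1.eigenvalues i = 1 := by
    have := hX.1.trace_eq_sum_eigenvalues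
    rw [h1] at this
    have h2 := congrArg Complex.re this
    rw [Complex.re_sum] at h2
    simpa using h2.symm
  refine Real.log_nonpos (hX.eigenvalues_pos i).le ?_
  rw [← hsum]
  exact Finset.single_le_sum (fun j _ => (hX.eigenvalues_pos j).le) (Finset.mem_univ i)

lemma herm_psd_conj {D : ℕ} {X A : Matrix (Fin D) (Fin D) ℂ} (hX : X.PosSemidef)
    (hA : A.IsHermitian) : (A * X * A).PosSemidef := by
  have := hX.mul_mul_conjTranspose_same A
  rwa [hA.eq] at this

lemma joint_convex {D : ℕ} {ι : Type*} (s : Finset ι) (w t : ι → ℝ)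
    (hw : ∀ i ∈ s, 0 < w i) (ht : ∀ i ∈ s, 0 < t i) (T : ℝ) (hT : T = ∑ i ∈ s, w i * t i)
    (hT0 : 0 < T) (X : Matrix (Fin D) (Fin D) ℂ) (hX : X.PosSemidef)
    (U : ι → Matrix (Fin D) (Fin D) ℂ) (hU : ∀ i ∈ s, (U i).IsHermitian)
    (Q : Matrix (Fin D) (Fin D) ℂ) (hQ : Q = ∑ i ∈ s, w i • U i) :
    Q * (T⁻¹ • X) * Q ≤ ∑ i ∈ s, w i • (U i * ((t i)⁻¹ • X) * U i) := by
  have hQh : Q.IsHermitian := by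
    rw [hQ]
    refine isSelfAdjoint_sum _ fun i hi => ?_
    exact (IsSelfAdjoint.all (w i)).smul (hU i hi)
  rw [Matrix.le_iff]
  have key : ∑ i ∈ s, w i • (U i * ((t i)⁻¹ • X) * U i) - Q * (T⁻¹ • X) * Q
      = ∑ i ∈ s, (w i * (t i)⁻¹) • ((U i - (t i * T⁻¹) • Q) * X * (U i - (t i * T⁻¹) • Q)) := by
    have e : ∀ i ∈ s, (w i * (t i)⁻¹) • ((U i - (t i * T⁻¹) • Q) * X * (U i - (t i * T⁻¹) • Q))
        = w i • (U i * ((t i)⁻¹ • X) * U i) - (w i • U i) * (T⁻¹ • (X * Q))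
          - (T⁻¹ • (Q * X)) * (w i • U i) + (w i * t i) • (T⁻¹ ^ 2 • (Q * X * Q)) := by
      intro i hi
      have := (ht i hi).ne'
      simp only [sub_mul, mul_sub, smul_sub, Matrix.smul_mul, Matrix.mul_smul, smul_smul, mul_assoc]
      have e1 : w i * ((t i)⁻¹ * (t i * T⁻¹)) = w i * T⁻¹ := by field_simp
      have e2 : w i * ((t i)⁻¹ * (t i * (T⁻¹ * (t i * T⁻¹)))) = w i * (t i * T⁻¹ ^ 2) := by
        field_simp
      rw [e1, e2]
      module
    rw [Finset.sum_congr rfl e, Finset.sum_add_distrib, Finset.sum_sub_distrib,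
      Finset.sum_sub_distrib, ← Finset.sum_mul, ← Finset.mul_sum, ← Finset.sum_smul, ← hT, ← hQ,
      smul_smul, show T * T⁻¹ ^ 2 = T⁻¹ by field_simp]
    simp only [Matrix.smul_mul, Matrix.mul_smul, mul_assoc]
    module
  rw [key]
  refine Matrix.posSemidef_sum _ fun i hi => ?_
  refine Matrix.PosSemidef.smul (herm_psd_conj hX ?_) (by have := hw i hi; have := ht i hi; positivity)
  refine (hU i hi).sub ?_
  exact (IsSelfAdjoint.all (t i * T⁻¹)).smul hQh

lemma log_R_convex {D N : ℕ} (hN : 0 < N) (M : Fin N → Matrix (Fin D) (Fin D) ℂ)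
    (hM : ∀ n, (M n).PosSemidef) (hMne : ∀ n, M n ≠ 0)
    (hker : ∀ v : Fin D → ℂ, (∀ n, (M n) *ᵥ v = 0) → v = 0)
    {ι : Type*} (s : Finset ι) (hs : s.Nonempty) (w : ι → ℝ) (hw : ∀ i ∈ s, 0 < w i)
    (hw1 : ∑ i ∈ s, w i = 1) (X : ι → Matrix (Fin D) (Fin D) ℂ) (hX : ∀ i ∈ s, (X i).PosDef) :
    mlog (Rmat M (∑ i ∈ s, w i • X i)) ≤ ∑ i ∈ s, w i • mlog (Rmat M (X i)) := by
  simp only [mlog_eq]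
  have psum : ∀ (Y : ι → Matrix (Fin D) (Fin D) ℂ), (∀ i ∈ s, (Y i).PosDef) →
      (∑ i ∈ s, w i • Y i).PosDef := by
    intro Y hY
    exact Matrix.posDef_sum hs fun i hi => (hY i hi).smul (hw i hi)
  have hXb := psum X hX
  have hR : ∀ i ∈ s, (Rmat M (X i)).PosDef := fun i hi =>
    Rmat_posDef hN M hM hMne hker _ (hX i hi)
  have hRb := Rmat_posDef hN M hM hMne hker _ hXb
  set Xb := ∑ i ∈ s, w i • X i with hXbdef
  set U : ι → Matrix (Fin D) (Fin D) ℂ := fun i => (Rmat M (X i))⁻¹ with hUdef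
  have hU : ∀ i ∈ s, (U i).PosDef := fun i hi => (hR i hi).inv
  have hQp := psum U hU
  set Q := ∑ i ∈ s, w i • U i with hQ
  have hT : ∀ n, (M n * Xb).trace.re = ∑ i ∈ s, w i * (M n * X i).trace.re := by
    intro n
    rw [hXbdef, Matrix.mul_sum, Matrix.trace_sum, Complex.re_sum]
    refine Finset.sum_congr rfl fun i _ => ?_
    rw [Matrix.mul_smul, Matrix.trace_smul, Complex.smul_re, smul_eq_mul]
  have hQRQ : Q * Rmat M Xb * Q ≤ Q := by
    have h1 : Q * Rmat M Xb * Q = (N : ℝ)⁻¹ • ∑ n, Q * ((M n * Xb).trace.re⁻¹ • M n) * Q := by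
      clear_value Q
      rw [Rmat, Matrix.mul_smul, Matrix.smul_mul, Matrix.mul_sum, Matrix.sum_mul]
    have h2 : Q = (N : ℝ)⁻¹ • ∑ n, ∑ i ∈ s, w i • (U i * ((M n * X i).trace.re⁻¹ • M n) * U i) := by
      rw [Finset.sum_comm, Finset.smul_sum, hQ]
      refine Finset.sum_congr rfl fun i hi => ?_
      rw [← Finset.smul_sum, ← Finset.sum_mul, ← Finset.mul_sum, smul_comm]
      have e3 : (N : ℝ)⁻¹ • (U i * (∑ n, (M n * X i).trace.re⁻¹ • M n) * U i)
          = (Rmat M (X i))⁻¹ * Rmat M (X i) * U i := by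
        rw [Rmat, Matrix.mul_smul, Matrix.smul_mul, hUdef]; rfl
      rw [e3]
      rw [Matrix.nonsing_inv_mul _ ((Matrix.isUnit_iff_isUnit_det _).1 (hR i hi).isUnit), one_mul]
    have h3 : ∑ n, Q * ((M n * Xb).trace.re⁻¹ • M n) * Q
        ≤ ∑ n, ∑ i ∈ s, w i • (U i * ((M n * X i).trace.re⁻¹ • M n) * U i) :=
      Finset.sum_le_sum fun n _ => joint_convex s w (fun i => (M n * X i).trace.re) hw
        (fun i hi => tr_mul_pos (hM n) (hMne n) (hX i hi)) _ (hT n)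
        (tr_mul_pos (hM n) (hMne n) hXb) _ (hM n) U (fun i hi => (hU i hi).1) Q hQ
    rw [h1]
    conv_rhs => rw [h2]
    rw [Matrix.le_iff, ← smul_sub]
    exact Matrix.PosSemidef.smul (Matrix.le_iff.1 h3) (by positivity)
  have hle : Rmat M Xb ≤ Q⁻¹ := by
    have hd := (Matrix.isUnit_iff_isUnit_det _).1 hQp.isUnit
    have := herm_psd_conj (Matrix.le_iff.1 hQRQ) hQp.inv.1
    rw [mul_sub, sub_mul, Matrix.nonsing_inv_mul _ hd, one_mul, mul_assoc Q, 
      ← mul_assoc Q⁻¹, Matrix.nonsing_inv_mul _ hd, one_mul, mul_assoc, Matrix.mul_nonsing_inv _ hd,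
      mul_one] at this
    exact Matrix.le_iff.2 this
  have l1 := CFC.log_le_log hle hRb.isStrictlyPositive
  rw [log_inv' _ hQp] at l1
  have l2 := (CFC.concaveOn_log (A := Matrix (Fin D) (Fin D) ℂ)).le_map_sum (t := s) (w := w) (p := U)
    (fun i hi => (hw i hi).le) hw1 (fun i hi => (hU i hi).isStrictlyPositive)
  refine l1.trans ?_
  rw [neg_le]
  refine le_trans (le_of_eq ?_) l2
  rw [← Finset.sum_neg_distrib]
  refine Finset.sum_congr rfl fun i hi => ?_
  rw [hUdef]
  simp only
  rw [log_inv' _ (hR i hi), smul_neg]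

lemma telescoping_main {D N : ℕ} (hD : 0 < D) (hN : 0 < N)
    (M : Fin N → Matrix (Fin D) (Fin D) ℂ)
    (hM : ∀ n, (M n).PosSemidef) (hMne : ∀ n, M n ≠ 0)
    (hker : ∀ v : Fin D → ℂ, (∀ n, (M n) *ᵥ v = 0) → v = 0)
    (ρ : ℕ → Matrix (Fin D) (Fin D) ℂ)
    (h0 : ρ 0 = (D : ℂ)⁻¹ • 1)
    (hstep : ∀ k, ρ (k + 1) =
      ((mexp (mlog (ρ k) + mlog (Rmat M (ρ k)))).trace)⁻¹ •
        mexp (mlog (ρ k) + mlog (Rmat M (ρ k))))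
    (ρbar : ℕ → Matrix (Fin D) (Fin D) ℂ)
    (hbar : ∀ k, ρbar k = (k : ℂ)⁻¹ • ∑ i ∈ Finset.range k, ρ i)
    (K : ℕ) (hK : 0 < K) (σ : Matrix (Fin D) (Fin D) ℂ) (hσ : σ.PosSemidef) (hσ1 : σ.trace = 1) :
      ((K : ℝ)⁻¹ * ∑ k ∈ Finset.range K, ((σ * mlog (Rmat M (ρ k))).trace).re ≤
        (K : ℝ)⁻¹ * ((σ * (mlog (ρ K) - mlog (ρ 0))).trace).re) ∧
      ((K : ℝ)⁻¹ * ((σ * (mlog (ρ K) - mlog (ρ 0))).trace).re ≤ Real.log D / K) ∧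
      ((σ * mlog (Rmat M (ρbar K))).trace).re ≤ Real.log D / K := by
  have : Nonempty (Fin D) := ⟨⟨0, hD⟩⟩
  have hDr : (0 : ℝ) < D := by exact_mod_cast hD
  have hKr : (0 : ℝ) < K := by exact_mod_cast hK
  have h0' : ρ 0 = algebraMap ℝ _ ((D : ℝ)⁻¹) := by
    rw [h0, Algebra.algebraMap_eq_smul_one]
    ext i j
    simp [Matrix.smul_apply]
  have hp0 : (ρ 0).PosDef := by
    rw [h0', Algebra.algebraMap_eq_smul_one]
    exact Matrix.PosDef.one.smul (inv_pos.2 hDr)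
  have ht0 : (ρ 0).trace = 1 := by
    rw [h0]; simp [hD.ne']
  have hpd : ∀ k, (ρ k).PosDef ∧ (ρ k).trace = 1 := by
    intro k
    induction k with
    | zero => exact ⟨hp0, ht0⟩
    | succ k ih =>
      have := step_facts hD hN M hM hMne hker _ _ ih.1 (hstep k)
      exact ⟨this.1, this.2.1⟩
  have hst : ∀ k, (σ * mlog (Rmat M (ρ k))).trace.re ≤
      (σ * mlog (ρ (k+1))).trace.re - (σ * mlog (ρ k)).trace.re := by
    intro k
    have h := tr_mono hσ (step_facts hD hN M hM hMne hker _ _ (hpd k).1 (hstep k)).2.2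
    rw [mul_add, Matrix.trace_add, Complex.add_re] at h
    linarith
  have htel : ∑ k ∈ Finset.range K, ((σ * mlog (Rmat M (ρ k))).trace).re ≤
      ((σ * (mlog (ρ K) - mlog (ρ 0))).trace).re := by
    refine (Finset.sum_le_sum fun k _ => hst k).trans (le_of_eq ?_)
    rw [Finset.sum_range_sub (fun k => (σ * mlog (ρ k)).trace.re), mul_sub, Matrix.trace_sub,
      Complex.sub_re]
  have hlog0 : (σ * mlog (ρ 0)).trace.re = - Real.log D := by
    rw [mlog_eq, h0', CFC.log_algebraMap, Algebra.algebraMap_eq_smul_one, Matrix.mul_smul, mul_one,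
      Matrix.trace_smul, hσ1, Complex.smul_re, Real.log_inv]
    simp
  have hend : ((σ * (mlog (ρ K) - mlog (ρ 0))).trace).re ≤ Real.log D := by
    have h := tr_mono hσ (log_nonpos' _ (hpd K).1 (hpd K).2)
    rw [mul_zero, Matrix.trace_zero, Complex.zero_re] at h
    rw [mul_sub, Matrix.trace_sub, Complex.sub_re, hlog0]
    linarith
  have c1 := mul_le_mul_of_nonneg_left htel (inv_pos.2 hKr).le
  have c2 : (K : ℝ)⁻¹ * ((σ * (mlog (ρ K) - mlog (ρ 0))).trace).re ≤ Real.log D / K := by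
    rw [div_eq_inv_mul]
    exact mul_le_mul_of_nonneg_left hend (inv_pos.2 hKr).le
  refine ⟨c1, c2, le_trans ?_ (c1.trans c2)⟩
  have hb : ρbar K = ∑ i ∈ Finset.range K, (K : ℝ)⁻¹ • ρ i := by
    rw [hbar, ← Finset.smul_sum]
    ext i j
    simp [Matrix.smul_apply]
  have hcv := log_R_convex hN M hM hMne hker (Finset.range K) ⟨0, by simpa using hK⟩
    (fun _ => (K : ℝ)⁻¹) (fun _ _ => inv_pos.2 hKr) (by simp [hKr.ne']) ρ (fun i _ => (hpd i).1)
  rw [← hb] at hcv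
  refine (tr_mono hσ hcv).trans (le_of_eq ?_)
  rw [← Finset.smul_sum, Matrix.mul_smul, Matrix.trace_smul, Complex.smul_re, smul_eq_mul,
    Matrix.mul_sum, Matrix.trace_sum, Complex.re_sum]

end helpers

/-- The telescoping bound in the proof of Theorem 1:
`(1/K) ∑_{k<K} tr(σ log R(ρ_k)) ≤ (1/K) tr(σ (log ρ_K − log ρ₀)) ≤ (log D)/K`, and
consequently `tr(σ log R(ρ̄_K)) ≤ (log D)/K` for every density matrix `σ`. -/
theorem stmt10 {D N : ℕ} (hD : 0 < D) (hN : 0 < N)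
    (M : Fin N → Matrix (Fin D) (Fin D) ℂ)
    (hM : ∀ n, (M n).PosSemidef) (hMne : ∀ n, M n ≠ 0)
    (hker : ∀ v : Fin D → ℂ, (∀ n, (M n) *ᵥ v = 0) → v = 0)
    (ρ : ℕ → Matrix (Fin D) (Fin D) ℂ)
    (h0 : ρ 0 = (D : ℂ)⁻¹ • 1)
    (hstep : ∀ k, ρ (k + 1) =
      ((mexp (mlog (ρ k) + mlog (Rmat M (ρ k)))).trace)⁻¹ •
        mexp (mlog (ρ k) + mlog (Rmat M (ρ k))))
    (ρbar : ℕ → Matrix (Fin D) (Fin D) ℂ)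
    (hbar : ∀ k, ρbar k = (k : ℂ)⁻¹ • ∑ i ∈ Finset.range k, ρ i) :
    ∀ K : ℕ, 0 < K → ∀ σ : Matrix (Fin D) (Fin D) ℂ, σ.PosSemidef → σ.trace = 1 →
      ((K : ℝ)⁻¹ * ∑ k ∈ Finset.range K, ((σ * mlog (Rmat M (ρ k))).trace).re ≤
        (K : ℝ)⁻¹ * ((σ * (mlog (ρ K) - mlog (ρ 0))).trace).re) ∧
      ((K : ℝ)⁻¹ * ((σ * (mlog (ρ K) - mlog (ρ 0))).trace).re ≤ Real.log D / K) ∧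
      ((σ * mlog (Rmat M (ρbar K))).trace).re ≤ Real.log D / K := by
  intro K hK σ hσ hσ1
  exact telescoping_main hD hN M hM hMne hker ρ h0 hstep ρbar hbar K hK σ hσ hσ1
end
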